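/- Under the stated assumptions on ξ and ε, if the cycle weights are α_j = γ log j with γ > 0 and ρ > ρ_c, so that ν = 1 − ρ_c/ρ > 0, then there is a single giant cycle containing almost all points in infinite cycles: in the thermodynamic limit |Λ|, N → ∞ with ρ = N/|Λ| fixed, ℓ^{(1)}/(νN) converges in distribution (hence in probability) to the constant 1. -/

import Mathlib

open MeasureTheory Filter Topology ENNReal FourierTransform

noncomputable section

/-! ### Permutation combinatorics -/

/-- `r_j(π)`: the number of cycles of length `j` in `π ∈ S_N`
(fixed points count as cycles of length 1). -/
def cycCount {N : ℕ} (π : Equiv.Perm (Fin N)) (j : ℕ) : ℕ :=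
  if j = 1 then N - π.cycleType.sum else Multiset.count j π.cycleType

/-- The cycle weight `exp(-∑_{j≥1} α_j r_j(π))` of a permutation `π ∈ S_N`. -/
def permWeight (α : ℕ → ℝ) {N : ℕ} (π : Equiv.Perm (Fin N)) : ℝ :=
  Real.exp (-∑ j ∈ Finset.Icc 1 N, α j * (cycCount π j : ℝ))

/-! ### The spatial model -/

/-- Euclidean space `ℝ^d`. -/
abbrev Eu (d : ℕ) := EuclideanSpace ℝ (Fin d)

/-- The lattice point `Lz ∈ ℝ^d`, for `z ∈ ℤ^d`. -/
def latPt (d : ℕ) (L : ℝ) (z : Fin d → ℤ) : Eu d :=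
  (WithLp.equiv 2 (Fin d → ℝ)).symm (fun i => L * (z i))

/-- The dual lattice point `z/L ∈ Λ* = L⁻¹ℤ^d`, for `z ∈ ℤ^d`. -/
def dualPt (d : ℕ) (L : ℝ) (z : Fin d → ℤ) : Eu d :=
  (WithLp.equiv 2 (Fin d → ℝ)).symm (fun i => (z i) / L)

/-- The cube `Λ ⊆ ℝ^d` of side `L`. -/
def cube (d : ℕ) (L : ℝ) : Set (Eu d) := {x | ∀ i, x i ∈ Set.Ico (0:ℝ) L}

/-- The periodization `e^{-ξ_Λ(x)} = ∑_{z∈ℤ^d} e^{-ξ(x-Lz)}` (values in `[0,∞]`),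
where `f = e^{-ξ}`. -/
def fper (d : ℕ) (f : Eu d → ℝ) (L : ℝ) (x : Eu d) : ℝ≥0∞ :=
  ∑' z : Fin d → ℤ, ENNReal.ofReal (f (x - latPt d L z))

/-- The (unnormalized) Gibbs weight of a permutation `π ∈ S_N`:
`e^{-∑_j α_j r_j(π)} ∫_{Λ^N} ∏_i e^{-ξ_Λ(x_i - x_{π(i)})} dx`. -/
def gibbsW (d : ℕ) (f : Eu d → ℝ) (α : ℕ → ℝ) (L : ℝ) (N : ℕ)
    (π : Equiv.Perm (Fin N)) : ℝ≥0∞ :=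
  ENNReal.ofReal (permWeight α π) *
    ∫⁻ x in Set.univ.pi (fun _ : Fin N => cube d L), ∏ i, fper d f L (x i - x (π i))

/-- The expectation, under the Gibbs measure on `Λ^N × S_N`, of a function of the
permutation alone. -/
def gibbsE (d : ℕ) (f : Eu d → ℝ) (α : ℕ → ℝ) (L : ℝ) (N : ℕ)
    (g : Equiv.Perm (Fin N) → ℝ) : ℝ :=
  (∑ π : Equiv.Perm (Fin N), (gibbsW d f α L N π).toReal * g π) /
    (∑ π : Equiv.Perm (Fin N), (gibbsW d f α L N π).toReal)

/-- The critical density `ρ_c = ∑_{j≥1} e^{-α_j} ∫_{ℝ^d} e^{-jε(k)} dk`. -/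
def rhoC (d : ℕ) (ε : Eu d → ℝ) (α : ℕ → ℝ) : ℝ :=
  ∑' j : ℕ, Real.exp (-α (j+1)) * ∫ k : Eu d, Real.exp (-(((j:ℝ)+1) * ε k))


/-- The multiset of cycle lengths of `π`, with multiplicity (fixed points included). -/
def cycleLens {N : ℕ} (π : Equiv.Perm (Fin N)) : Multiset ℕ :=
  π.cycleType + Multiset.replicate (N - π.cycleType.sum) 1

/-- `ℓ^{(i+1)}(π)`: the `(i+1)`-th largest cycle length of `π` (`i` is 0-indexed). -/
def ellD {N : ℕ} (π : Equiv.Perm (Fin N)) (i : ℕ) : ℕ :=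
  (((cycleLens π).sort (· ≤ ·)).reverse).getD i 0

open scoped Classical in
/-- The probability, under the Gibbs measure on `Λ^N × S_N`, of an event depending on
the permutation alone. -/
def gibbsP (d : ℕ) (f : Eu d → ℝ) (α : ℕ → ℝ) (L : ℝ) (N : ℕ)
    (A : Set (Equiv.Perm (Fin N))) : ℝ :=
  (∑ π : Equiv.Perm (Fin N), if π ∈ A then (gibbsW d f α L N π).toReal else 0) /
    (∑ π : Equiv.Perm (Fin N), (gibbsW d f α L N π).toReal)

section PoissonFamily

open ProbabilityTheory
open scoped NNReal

variable {ι : Type*} [Fintype ι]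

/-- The law of a finite family of independent Poisson variables with rates `lam i`. -/
def poissonPi (lam : ι → ℝ≥0) : Measure (ι → ℕ) :=
  Measure.pi fun i => poissonMeasure (lam i)

instance (lam : ι → ℝ≥0) : IsProbabilityMeasure (poissonPi lam) := by
  unfold poissonPi; infer_instance

lemma poissonPi_real_singleton (lam : ι → ℝ≥0) (w : ι → ℕ) :
    (poissonPi lam).real {w} =
      Real.exp (-∑ i, (lam i : ℝ)) * ∏ i, (lam i : ℝ) ^ w i / (w i).factorial := by
  rw [measureReal_def, poissonPi, Measure.pi_singleton, ENNReal.toReal_prod]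
  simp_rw [← measureReal_def, poissonMeasure_real_singleton, mul_div_assoc]
  rw [Finset.prod_mul_distrib, ← Real.exp_sum, Finset.sum_neg_distrib]

/-- The linear statistic `∑ c i * w i` of a family of counts. -/
def linStat (c : ι → ℕ) (w : ι → ℕ) : ℕ := ∑ i, c i * w i

variable [DecidableEq ι]

lemma linStat_add_single (c w : ι → ℕ) (i : ι) :
    linStat c (w + Pi.single i 1) = linStat c w + c i := by
  simp [linStat, mul_add, Finset.sum_add_distrib, Pi.single_apply]

lemma poissonPi_singleton_add_single (lam : ι → ℝ≥0) (w : ι → ℕ) (i : ι) :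
    ((w i + 1 : ℕ) : ℝ≥0∞) * poissonPi lam {w + Pi.single i 1} =
      lam i * poissonPi lam {w} := by
  have h : ((w i + 1 : ℕ) : ℝ) * (poissonPi lam).real {w + Pi.single i 1} =
      lam i * (poissonPi lam).real {w} := by
    rw [poissonPi_real_singleton, poissonPi_real_singleton,
      ← Finset.mul_prod_erase _ _ (Finset.mem_univ i),
      ← Finset.mul_prod_erase (s := Finset.univ)
        (f := fun j => (lam j : ℝ) ^ w j / (w j).factorial) (a := i) (Finset.mem_univ i)]
    have h1 : ∏ x ∈ Finset.univ.erase i,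
        (lam x : ℝ) ^ (w + Pi.single i 1 : ι → ℕ) x / ((w + Pi.single i 1 : ι → ℕ) x).factorial =
        ∏ x ∈ Finset.univ.erase i, (lam x : ℝ) ^ w x / (w x).factorial := by
      refine Finset.prod_congr rfl fun x hx => ?_
      simp [(Finset.mem_erase.1 hx).1]
    rw [h1]
    simp only [Pi.add_apply, Pi.single_eq_same, Nat.factorial_succ, pow_succ]
    push_cast
    have : ((w i).factorial : ℝ) ≠ 0 := by positivity
    have : ((w i : ℝ) + 1) ≠ 0 := by positivity
    field_simp
  have h2 := congrArg ENNReal.ofReal h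
  rwa [ENNReal.ofReal_mul (by positivity), ENNReal.ofReal_mul (by positivity),
    ENNReal.ofReal_natCast, ofReal_measureReal, ofReal_measureReal,
    ENNReal.ofReal_coe_nnreal] at h2

/-- The Mecke formula for a family of independent Poisson variables. -/
lemma lintegral_apply_mul_poissonPi (lam : ι → ℝ≥0) (i : ι) (g : (ι → ℕ) → ℝ≥0∞) :
    ∫⁻ w, (w i : ℝ≥0∞) * g w ∂poissonPi lam =
      lam i * ∫⁻ w, g (w + Pi.single i 1) ∂poissonPi lam := by
  rw [lintegral_countable', lintegral_countable', ← ENNReal.tsum_mul_left]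
  have hinj : Function.Injective fun w : ι → ℕ => w + Pi.single i 1 :=
    fun a b h => add_right_cancel h
  rw [← hinj.tsum_eq]
  · refine tsum_congr fun w => ?_
    have := poissonPi_singleton_add_single lam w i
    simp only [Pi.add_apply, Pi.single_eq_same]
    rw [mul_right_comm, this]
    ring
  · intro w hw
    have hwi : w i ≠ 0 := by
      intro h0; simp [h0] at hw
    refine ⟨w - (Pi.single i 1 : ι → ℕ), ?_⟩
    ext j
    by_cases hj : j = i
    · subst hj; simp; omega
    · simp [hj]

lemma lintegral_linStat_indicator (lam : ι → ℝ≥0) (c : ι → ℕ) (A : Set (ι → ℕ)) :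
    ∫⁻ w, (linStat c w : ℝ≥0∞) * A.indicator 1 w ∂poissonPi lam =
      ENNReal.ofReal (∑ i, c i * lam i * (poissonPi lam).real {w | w + Pi.single i 1 ∈ A}) := by
  have h : ∀ w : ι → ℕ, (linStat c w : ℝ≥0∞) * A.indicator 1 w =
      ∑ i, (c i : ℝ≥0∞) * ((w i : ℝ≥0∞) * A.indicator 1 w) := by
    intro w
    simp only [linStat, Nat.cast_sum, Nat.cast_mul, Finset.sum_mul, mul_assoc]
  simp_rw [h]
  rw [lintegral_finsetSum _ fun i _ => measurable_of_countable _,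
    ENNReal.ofReal_sum_of_nonneg fun i _ => by positivity]
  refine Finset.sum_congr rfl fun i _ => ?_
  rw [lintegral_const_mul _ (measurable_of_countable _), lintegral_apply_mul_poissonPi,
    ENNReal.ofReal_mul (by positivity), ENNReal.ofReal_mul (by positivity),
    ENNReal.ofReal_natCast, ENNReal.ofReal_coe_nnreal, ofReal_measureReal, mul_assoc]
  congr 2
  rw [← lintegral_indicator_one (Set.to_countable _).measurableSet]
  rfl

/-- Lower bound on a linear statistic over `A` turned into an upper bound on the mass of `A`. -/
lemma mul_real_le_of_le_linStat (lam : ι → ℝ≥0) (c : ι → ℕ) (A : Set (ι → ℕ)) (t : ℝ)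
    (h : ∀ w ∈ A, t ≤ linStat c w) :
    t * (poissonPi lam).real A ≤
      ∑ i, c i * lam i * (poissonPi lam).real {w | w + Pi.single i 1 ∈ A} := by
  have hs : 0 ≤ ∑ i, c i * lam i * (poissonPi lam).real {w | w + Pi.single i 1 ∈ A} := by
    positivity
  rcases le_or_gt t 0 with ht | ht
  · exact (mul_nonpos_of_nonpos_of_nonneg ht (by positivity)).trans hs
  rw [← ENNReal.ofReal_le_ofReal_iff hs, ← lintegral_linStat_indicator,
    ENNReal.ofReal_mul ht.le, ofReal_measureReal,
    ← lintegral_indicator_one (Set.to_countable A).measurableSet,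
    ← lintegral_const_mul _ (measurable_of_countable _)]
  refine lintegral_mono fun w => ?_
  by_cases hw : w ∈ A
  · simp only [hw, Set.indicator_of_mem, Pi.one_apply, mul_one]
    rw [← ENNReal.ofReal_natCast]
    exact ENNReal.ofReal_le_ofReal (h w hw)
  · simp [hw]

/-- Upper bound on a linear statistic over `A` turned into a lower bound on the mass of `A`. -/
lemma sum_le_mul_real_of_linStat_le (lam : ι → ℝ≥0) (c : ι → ℕ) (A : Set (ι → ℕ)) (t : ℝ)
    (ht : 0 ≤ t) (h : ∀ w ∈ A, linStat c w ≤ t) :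
    ∑ i, c i * lam i * (poissonPi lam).real {w | w + Pi.single i 1 ∈ A} ≤
      t * (poissonPi lam).real A := by
  rw [← ENNReal.ofReal_le_ofReal_iff (by positivity), ← lintegral_linStat_indicator,
    ENNReal.ofReal_mul ht, ofReal_measureReal,
    ← lintegral_indicator_one (Set.to_countable A).measurableSet,
    ← lintegral_const_mul _ (measurable_of_countable _)]
  refine lintegral_mono fun w => ?_
  by_cases hw : w ∈ A
  · simp only [hw, Set.indicator_of_mem, Pi.one_apply, mul_one]
    rw [← ENNReal.ofReal_natCast]
    exact ENNReal.ofReal_le_ofReal (h w hw)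
  · simp [hw]

/-- Exponential upper tail of a linear statistic with coefficients at most `M`. -/
lemma linStat_upper_tail (lam : ι → ℝ≥0) (c : ι → ℕ) (M t θ : ℝ) (ht : 0 < t)
    (hc : ∀ i, c i ≤ M) (hM : 0 ≤ M) (hθ : 0 ≤ θ) (hm : ∑ i, (c i : ℝ) * lam i ≤ θ * t) (k : ℕ) :
    (poissonPi lam).real {w | t + k * M ≤ linStat c w} ≤ θ ^ k := by
  induction k with
  | zero => simp
  | succ k ih =>
    set a := (poissonPi lam).real {w | t + k * M ≤ linStat c w} with ha
    set b := (poissonPi lam).real {w | t + (k + 1 : ℕ) * M ≤ linStat c w} with hb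
    have h1 := mul_real_le_of_le_linStat lam c {w | t + (k + 1 : ℕ) * M ≤ linStat c w}
      (t + (k + 1 : ℕ) * M) (fun w hw => hw)
    have h2 : ∑ i, c i * lam i * (poissonPi lam).real
        {w | w + Pi.single i 1 ∈ {w : ι → ℕ | t + (k + 1 : ℕ) * M ≤ linStat c w}} ≤
        ∑ i, c i * lam i * a := by
      refine Finset.sum_le_sum fun i _ => mul_le_mul_of_nonneg_left ?_ (by positivity)
      refine measureReal_mono fun w hw => ?_
      simp only [Set.mem_ofPred_eq, linStat_add_single] at hw ⊢
      push_cast at hw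
      linarith [hc i]
    rw [← Finset.sum_mul] at h2
    have h3 : t * b ≤ θ * t * a := by
      calc t * b ≤ (t + (k + 1 : ℕ) * M) * b := by
            refine mul_le_mul_of_nonneg_right ?_ (by positivity)
            have : 0 ≤ ((k + 1 : ℕ) : ℝ) * M := by positivity
            linarith
        _ ≤ _ := h1
        _ ≤ _ := h2
        _ ≤ _ := mul_le_mul_of_nonneg_right hm (by positivity)
    have h4 : b ≤ θ * a := by
      have : t * b ≤ t * (θ * a) := by linarith
      exact le_of_mul_le_mul_left this ht
    calc b ≤ θ * a := h4
      _ ≤ θ * θ ^ k := mul_le_mul_of_nonneg_left ih hθ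
      _ = θ ^ (k + 1) := by ring

/-- Exponential lower tail of a linear statistic with coefficients at most `M`. -/
lemma linStat_lower_tail (lam : ι → ℝ≥0) (c : ι → ℕ) (M t θ : ℝ)
    (hc : ∀ i, c i ≤ M) (hM : 0 ≤ M) (hθ : 0 ≤ θ) (hm0 : 0 < ∑ i, (c i : ℝ) * lam i)
    (hm : t ≤ θ * ∑ i, (c i : ℝ) * lam i) (k : ℕ) :
    (poissonPi lam).real {w | (linStat c w : ℝ) ≤ t - k * M} ≤ θ ^ k := by
  induction k with
  | zero => simp
  | succ k ih =>
    set a := (poissonPi lam).real {w | (linStat c w : ℝ) ≤ t - k * M} with ha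
    set b := (poissonPi lam).real {w | (linStat c w : ℝ) ≤ t - (k + 1 : ℕ) * M} with hb
    rcases lt_or_ge (t - (k + 1 : ℕ) * M) 0 with hneg | hpos
    · have : {w : ι → ℕ | (linStat c w : ℝ) ≤ t - (k + 1 : ℕ) * M} = ∅ := by
        ext w
        simp only [Set.mem_ofPred_eq, Set.mem_empty_iff_false, iff_false, not_le]
        exact hneg.trans_le (by positivity)
      rw [hb, this]
      simp only [measureReal_empty]
      positivity
    have hpos' : 0 ≤ t - k * M := by
      push_cast at hpos
      linarith
    have h1 := sum_le_mul_real_of_linStat_le lam c {w | (linStat c w : ℝ) ≤ t - k * M}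
      (t - k * M) hpos' (fun w hw => hw)
    have h2 : ∑ i, c i * lam i * b ≤ ∑ i, c i * lam i * (poissonPi lam).real
        {w | w + Pi.single i 1 ∈ {w : ι → ℕ | (linStat c w : ℝ) ≤ t - k * M}} := by
      refine Finset.sum_le_sum fun i _ => mul_le_mul_of_nonneg_left ?_ (by positivity)
      refine measureReal_mono fun w hw => ?_
      simp only [Set.mem_ofPred_eq, linStat_add_single] at hw ⊢
      push_cast at hw ⊢
      linarith [hc i]
    rw [← Finset.sum_mul] at h2
    set m := ∑ i, (c i : ℝ) * lam i
    have h3 : m * b ≤ m * (θ * a) := by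
      calc m * b ≤ _ := h2
        _ ≤ _ := h1
        _ ≤ t * a := by
            refine mul_le_mul_of_nonneg_right ?_ (by positivity)
            have : 0 ≤ (k : ℝ) * M := by positivity
            linarith
        _ ≤ θ * m * a := mul_le_mul_of_nonneg_right hm (by positivity)
        _ = m * (θ * a) := by ring
    have h4 : b ≤ θ * a := le_of_mul_le_mul_left h3 hm0
    calc b ≤ θ * a := h4
      _ ≤ θ * θ ^ k := mul_le_mul_of_nonneg_left ih hθ
      _ = θ ^ (k + 1) := by ring

/-- The number of events with `0/1` coefficients exceeds `r` with probability at most `m ^ r`. -/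
lemma linStat_count_tail (lam : ι → ℝ≥0) (c : ι → ℕ) (hc : ∀ i, c i ≤ 1) (r : ℕ) :
    (poissonPi lam).real {w | r ≤ linStat c w} ≤ (∑ i, (c i : ℝ) * lam i) ^ r := by
  induction r with
  | zero => simp
  | succ r ih =>
    have h1 := mul_real_le_of_le_linStat lam c {w | r + 1 ≤ linStat c w} (r + 1)
      (fun w hw => by exact_mod_cast hw)
    have h2 : ∑ i, c i * lam i * (poissonPi lam).real
        {w | w + Pi.single i 1 ∈ {w : ι → ℕ | r + 1 ≤ linStat c w}} ≤
        ∑ i, c i * lam i * (poissonPi lam).real {w | r ≤ linStat c w} := by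
      refine Finset.sum_le_sum fun i _ => mul_le_mul_of_nonneg_left ?_ (by positivity)
      refine measureReal_mono fun w hw => ?_
      simp only [Set.mem_ofPred_eq, linStat_add_single] at hw ⊢
      have := hc i
      omega
    rw [← Finset.sum_mul] at h2
    have h3 : (poissonPi lam).real {w | r + 1 ≤ linStat c w} ≤
        ((r : ℝ) + 1) * (poissonPi lam).real {w | r + 1 ≤ linStat c w} :=
      le_mul_of_one_le_left (by positivity) (by linarith [Nat.cast_nonneg (α := ℝ) r])
    calc _ ≤ _ := h3.trans (h1.trans h2)
      _ ≤ (∑ i, (c i : ℝ) * lam i) * (∑ i, (c i : ℝ) * lam i) ^ r :=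
        mul_le_mul_of_nonneg_left ih (by positivity)
      _ = _ := by ring

omit [DecidableEq ι] in
lemma sum_real_linStat_add_eq_le_one (lam : ι → ℝ≥0) (ℓ : ι → ℕ) (hℓ : Function.Injective ℓ)
    (n : ℕ) : ∑ i, (poissonPi lam).real {w | linStat ℓ w + ℓ i = n} ≤ 1 := by
  rw [← measureReal_biUnion_finset]
  · exact measureReal_le_one
  · intro i _ j _ hij
    refine Set.disjoint_left.2 fun w hi hj => hij (hℓ ?_)
    simp only [Set.mem_ofPred_eq] at hi hj
    omega
  · exact fun i _ => (Set.to_countable _).measurableSet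

/-- Two events with small rates, jointly with a prescribed total, are unlikely. -/
lemma linStat_two_le (lam : ι → ℝ≥0) (c ℓ : ι → ℕ) (hc : ∀ i, c i ≤ 1)
    (hℓ : Function.Injective ℓ) (n : ℕ) (B : ℝ) (hB : 0 ≤ B) (hlam : ∀ i, c i * lam i ≤ B) :
    (poissonPi lam).real {w | 2 ≤ linStat c w ∧ linStat ℓ w = n} ≤
      (∑ i, (c i : ℝ) * lam i) * B := by
  have key : ∀ k : ℕ, (poissonPi lam).real {w | 1 ≤ linStat c w ∧ linStat ℓ w + k = n} ≤ B := by
    intro k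
    have h1 := mul_real_le_of_le_linStat lam c {w | 1 ≤ linStat c w ∧ linStat ℓ w + k = n} 1
      (fun w hw => by exact_mod_cast hw.1)
    rw [one_mul] at h1
    refine h1.trans ?_
    calc _ ≤ ∑ i, B * (poissonPi lam).real {w | linStat ℓ w + ℓ i = n - k} := by
          refine Finset.sum_le_sum fun i _ => mul_le_mul (hlam i) ?_ (by positivity) hB
          refine measureReal_mono fun w hw => ?_
          simp only [Set.mem_ofPred_eq, linStat_add_single] at hw ⊢
          omega
      _ ≤ B * 1 := by
          rw [← Finset.mul_sum]
          exact mul_le_mul_of_nonneg_left (sum_real_linStat_add_eq_le_one lam ℓ hℓ _) hB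
      _ = B := mul_one B
  have h1 := mul_real_le_of_le_linStat lam c {w | 2 ≤ linStat c w ∧ linStat ℓ w = n} 1
    (fun w hw => by exact_mod_cast (le_trans (by norm_num) hw.1))
  rw [one_mul] at h1
  refine h1.trans ?_
  rw [Finset.sum_mul]
  refine Finset.sum_le_sum fun i _ => mul_le_mul_of_nonneg_left ?_ (by positivity)
  refine (measureReal_mono fun w hw => ?_).trans (key (ℓ i))
  simp only [Set.mem_ofPred_eq, linStat_add_single] at hw ⊢
  have := hc i
  omega

/-- If every length up to `n` occurs and has weight at least `b`, the total equals `n` with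
probability at least a constant times `b / n`. -/
lemma mul_real_linStat_lt_le (lam : ι → ℝ≥0) (ℓ : ι → ℕ) (n : ℕ) (b : ℝ) (hb : 0 ≤ b)
    (hsurj : ∀ k, 1 ≤ k → k ≤ n → ∃ i, ℓ i = k) (hlam : ∀ i, b ≤ ℓ i * lam i) :
    b * (poissonPi lam).real {w | linStat ℓ w < n} ≤
      n * (poissonPi lam).real {w | linStat ℓ w = n} := by
  have h1 := sum_le_mul_real_of_linStat_le lam ℓ {w | linStat ℓ w = n} n (by positivity)
    (fun w hw => by rw [show linStat ℓ w = n from hw])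
  refine le_trans ?_ h1
  calc b * (poissonPi lam).real {w | linStat ℓ w < n}
      ≤ b * ∑ i, (poissonPi lam).real {w | linStat ℓ w + ℓ i = n} := by
        refine mul_le_mul_of_nonneg_left ?_ hb
        refine le_trans (measureReal_mono (fun w hw => ?_) (measure_ne_top _ _))
          (measureReal_biUnion_finset_le Finset.univ _)
        simp only [Set.mem_ofPred_eq] at hw
        obtain ⟨i, hi⟩ := hsurj (n - linStat ℓ w) (by omega) (by omega)
        simp only [Finset.mem_univ, Set.iUnion_true, Set.mem_iUnion, Set.mem_ofPred_eq]
        exact ⟨i, by omega⟩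
    _ ≤ _ := by
        rw [Finset.mul_sum]
        refine Finset.sum_le_sum fun i _ => ?_
        simp only [Set.mem_ofPred_eq, linStat_add_single]
        exact mul_le_mul_of_nonneg_right (hlam i) (by positivity)

end PoissonFamily

section BigJump

open scoped NNReal

variable {ι : Type*} [Fintype ι]

/-- Counts of total size `n` with few long cycles, a typical number of points in short cycles and
at most one very long cycle have their longest cycle close to `(1 - σ) n`. -/
lemma exists_long_of_typical (ℓ w : ι → ℕ) (n r : ℕ) (M D σ e : ℝ) (hDpos : 0 ≤ D)
    (hn : linStat ℓ w = n)
    (hr : linStat (fun i => if M ≤ ℓ i then 1 else 0) w < r)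
    (hlow : (σ - e) * n < linStat (fun i => if (ℓ i : ℝ) < M then ℓ i else 0) w)
    (hupp : linStat (fun i => if (ℓ i : ℝ) < M then ℓ i else 0) w < (σ + e) * n)
    (hK : linStat (fun i => if D ≤ ℓ i then 1 else 0) w < 2)
    (hrD : r * D ≤ e * n) (hT : 0 ≤ 1 - σ - 2 * e) (hM : M ≤ (1 - σ + e) * n) :
    (∃ i, w i ≠ 0 ∧ (1 - σ - 2 * e) * n ≤ ℓ i) ∧ ∀ i, w i ≠ 0 → (ℓ i : ℝ) ≤ (1 - σ + e) * n := by
  classical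
  constructor
  · by_contra! hcon
    have hmain : (linStat ℓ w : ℝ) ≤
        linStat (fun i => if (ℓ i : ℝ) < M then ℓ i else 0) w +
        D * linStat (fun i => if M ≤ ℓ i then 1 else 0) w +
        (1 - σ - 2 * e) * n * linStat (fun i => if D ≤ ℓ i then 1 else 0) w := by
      simp only [linStat]
      push_cast
      rw [Finset.mul_sum, Finset.mul_sum, ← Finset.sum_add_distrib, ← Finset.sum_add_distrib]
      refine Finset.sum_le_sum fun i _ => ?_
      rcases eq_or_ne (w i) 0 with h0 | h0
      · simp [h0]
      have hw : (0 : ℝ) ≤ w i := by positivity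
      have hT' : 0 ≤ (1 - σ - 2 * e) * n := by positivity
      by_cases h1 : (ℓ i : ℝ) < M
      · simp only [h1, if_true, not_le.2 h1, if_false, zero_mul, mul_zero, add_zero]
        refine le_add_of_nonneg_right ?_
        positivity
      · simp only [h1, if_false, not_lt.1 h1, if_true, zero_mul, zero_add, one_mul]
        by_cases h2 : D ≤ (ℓ i : ℝ)
        · simp only [h2, if_true, one_mul]
          have := mul_le_mul_of_nonneg_right (hcon i h0).le hw
          have : 0 ≤ D * w i := by positivity
          linarith
        · simp only [h2, if_false, zero_mul, mul_zero, add_zero]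
          exact mul_le_mul_of_nonneg_right (not_le.1 h2).le hw
    have hK' : (linStat (fun i => if D ≤ ℓ i then 1 else 0) w : ℝ) ≤ 1 := by
      exact_mod_cast Nat.lt_succ_iff.1 hK
    have hr' : (linStat (fun i => if M ≤ ℓ i then 1 else 0) w : ℝ) ≤ r := by exact_mod_cast hr.le
    have h3 := mul_le_mul_of_nonneg_left hr' hDpos
    have h4 := mul_le_mul_of_nonneg_left hK' (show 0 ≤ (1 - σ - 2 * e) * n by positivity)
    rw [hn] at hmain
    nlinarith
  · intro i hi
    by_cases h1 : (ℓ i : ℝ) < M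
    · exact h1.le.trans hM
    have h2 : linStat (fun i => if (ℓ i : ℝ) < M then ℓ i else 0) w + ℓ i ≤ linStat ℓ w := by
      simp only [linStat]
      rw [← Finset.add_sum_erase _ _ (Finset.mem_univ i),
        ← Finset.add_sum_erase Finset.univ (fun j => ℓ j * w j) (Finset.mem_univ i)]
      have h3 : ∑ x ∈ Finset.univ.erase i, (if (ℓ x : ℝ) < M then ℓ x else 0) * w x ≤
          ∑ x ∈ Finset.univ.erase i, ℓ x * w x := by
        refine Finset.sum_le_sum fun x _ => Nat.mul_le_mul_right _ ?_
        split_ifs <;> simp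
      have h4 : ℓ i ≤ ℓ i * w i := Nat.le_mul_of_pos_right _ (Nat.pos_of_ne_zero hi)
      simp only [h1, if_false, zero_mul]
      omega
    have h3 : (linStat (fun i => if (ℓ i : ℝ) < M then ℓ i else 0) w : ℝ) + ℓ i ≤ n := by
      exact_mod_cast hn ▸ h2
    linarith

lemma tendsto_rpow_mul_pow_floor {θ c p s : ℝ} (hθ0 : 0 < θ) (hθ1 : θ < 1) (hc : 0 < c)
    (hp : 1 < p) :
    Tendsto (fun x : ℝ => x ^ s * θ ^ ⌊c * x / x ^ (1 / p)⌋₊) atTop (𝓝 0) := by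
  have hq : 0 < 1 - 1 / p := by
    have := (div_lt_one (by linarith : (0:ℝ) < p)).2 hp
    linarith
  have hb : 0 < c * (-Real.log θ) := by
    have := Real.log_neg hθ0 hθ1
    nlinarith
  have h1 := (tendsto_rpow_mul_exp_neg_mul_atTop_nhds_zero (s / (1 - 1 / p)) _ hb).comp
    (tendsto_rpow_atTop hq)
  have h2 := h1.const_mul θ⁻¹
  rw [mul_zero] at h2
  refine squeeze_zero' ?_ ?_ h2
  · filter_upwards [eventually_gt_atTop 0] with x hx
    positivity
  · filter_upwards [eventually_gt_atTop 0] with x hx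
    have e1 : c * x / x ^ (1 / p) = c * x ^ (1 - 1 / p) := by
      rw [Real.rpow_sub hx, Real.rpow_one]; ring
    have e2 : (x ^ (1 - 1 / p)) ^ (s / (1 - 1 / p)) = x ^ s := by
      rw [← Real.rpow_mul hx.le, mul_div_cancel₀ _ hq.ne']
    have e3 : θ ^ ⌊c * x / x ^ (1 / p)⌋₊ ≤
        θ⁻¹ * Real.exp (-(c * -Real.log θ) * x ^ (1 - 1 / p)) := by
      rw [← Real.rpow_natCast, e1]
      have hfl : c * x ^ (1 - 1 / p) - 1 ≤ (⌊c * x ^ (1 - 1 / p)⌋₊ : ℝ) :=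
        (Nat.sub_one_lt_floor _).le
      refine (Real.rpow_le_rpow_of_exponent_ge hθ0 hθ1.le hfl).trans_eq ?_
      rw [Real.rpow_sub hθ0, Real.rpow_one, Real.rpow_def_of_pos hθ0, div_eq_inv_mul]
      congr 2
      ring
    simp only [Function.comp_apply]
    rw [e2]
    calc _ ≤ x ^ s * (θ⁻¹ * Real.exp (-(c * -Real.log θ) * x ^ (1 - 1 / p))) :=
          mul_le_mul_of_nonneg_left e3 (by positivity)
      _ = _ := by ring

/-- The lengths `1, …, n` indexed by `Fin n`. -/
def len (n : ℕ) (i : Fin n) : ℕ := i + 1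

lemma len_injective (n : ℕ) : Function.Injective (len n) := fun i j h => by
  simp only [len] at h
  exact Fin.ext (by omega)

/-- The Poisson rates `w j / j` of the number of cycles of length `j`. -/
def rate (w : ℕ → ℝ≥0) (n : ℕ) (i : Fin n) : ℝ≥0 := w (len n i) / len n i

lemma len_mul_rate (w : ℕ → ℝ≥0) (n : ℕ) (i : Fin n) :
    (len n i : ℝ) * rate w n i = w (len n i) := by
  have : (len n i : ℝ) ≠ 0 := by simp only [len]; positivity
  simp only [rate, NNReal.coe_div, NNReal.coe_natCast]
  field_simp

lemma sum_len (n : ℕ) (g : ℕ → ℝ) : ∑ i, g (len n i) = ∑ j ∈ Finset.Icc 1 n, g j := by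
  simp only [len]
  rw [Fin.sum_univ_eq_sum_range (fun i => g (i + 1)) n, Finset.range_eq_Ico,
    Finset.sum_Ico_add' g 0 n 1]
  rfl

lemma sum_len_mul_rate (w : ℕ → ℝ≥0) (n : ℕ) (P : ℕ → Prop) [DecidablePred P] :
    ∑ i, ((if P (len n i) then len n i else 0 : ℕ) : ℝ) * rate w n i =
      ∑ j ∈ Finset.Icc 1 n, if P j then (w j : ℝ) else 0 := by
  rw [← sum_len n fun j => if P j then (w j : ℝ) else 0]
  refine Finset.sum_congr rfl fun i _ => ?_
  split_ifs
  · exact len_mul_rate w n i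
  · simp

lemma rate_le {w : ℕ → ℝ≥0} {n : ℕ} {C γ M : ℝ} (h : ∀ j : ℕ, M ≤ j → w j ≤ C * (j : ℝ) ^ (-γ))
    (i : Fin n) (hi : M ≤ len n i) : (rate w n i : ℝ) ≤ C * (len n i : ℝ) ^ (-1 - γ) := by
  have hpos : (0 : ℝ) < len n i := by simp only [len]; positivity
  rw [show -1 - γ = -γ - 1 by ring, Real.rpow_sub hpos, Real.rpow_one, ← mul_div_assoc,
    le_div_iff₀ hpos, mul_comm, len_mul_rate]
  exact h _ hi

lemma sum_rate_le {w : ℕ → ℝ≥0} {n : ℕ} {C γ M : ℝ} (hγ : 0 < γ) (hC : 0 ≤ C) (hM : 0 < M)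
    (h : ∀ j : ℕ, M ≤ j → w j ≤ C * (j : ℝ) ^ (-γ)) :
    ∑ i, ((if M ≤ len n i then 1 else 0 : ℕ) : ℝ) * rate w n i ≤
      C * (∑' j : ℕ, ((j : ℝ) + 1) ^ (-1 - γ / 2)) * M ^ (-(γ / 2)) := by
  have hs : Summable fun j : ℕ => ((j : ℝ) + 1) ^ (-1 - γ / 2) := by
    have := (summable_nat_add_iff 1).2 (Real.summable_nat_rpow.2 (by linarith : -1 - γ / 2 < -1))
    simpa using this
  have h1 : ∀ i : Fin n, ((if M ≤ len n i then 1 else 0 : ℕ) : ℝ) * rate w n i ≤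
      C * M ^ (-(γ / 2)) * ((i : ℝ) + 1) ^ (-1 - γ / 2) := by
    intro i
    split_ifs with hi
    · have hl : (len n i : ℝ) = (i : ℝ) + 1 := by simp [len]
      rw [Nat.cast_one, one_mul]
      refine (rate_le h i hi).trans ?_
      rw [mul_assoc]
      refine mul_le_mul_of_nonneg_left ?_ hC
      rw [hl] at hi ⊢
      rw [show -1 - γ = -(γ / 2) + (-1 - γ / 2) by ring, Real.rpow_add (by positivity)]
      refine mul_le_mul_of_nonneg_right ?_ (by positivity)
      exact Real.rpow_le_rpow_of_nonpos hM hi (by linarith)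
    · rw [Nat.cast_zero, zero_mul]; positivity
  refine (Finset.sum_le_sum fun i _ => h1 i).trans ?_
  rw [← Finset.mul_sum, Fin.sum_univ_eq_sum_range (fun i => ((i : ℝ) + 1) ^ (-1 - γ / 2)) n]
  have := hs.sum_le_tsum (Finset.range n) fun i _ => by positivity
  calc _ ≤ C * M ^ (-(γ / 2)) * ∑' j : ℕ, ((j : ℝ) + 1) ^ (-1 - γ / 2) :=
        mul_le_mul_of_nonneg_left this (by positivity)
    _ = _ := by ring

/-- The probability of a prescribed total size is at least of order `n ^ (-1 - γ)`. -/
lemma le_rpow_mul_real_linStat_eq {w : ℕ → ℝ≥0} {n : ℕ} {γ c : ℝ} (hn : 0 < n) (hγ : 0 < γ)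
    (hlow : ∀ j : ℕ, 1 ≤ j → (j : ℝ) ^ (-γ) ≤ w j)
    (hsum : ∑ j ∈ Finset.Icc 1 n, (w j : ℝ) ≤ (1 - c) * n) :
    c ≤ (n : ℝ) ^ (1 + γ) * (poissonPi (rate w n)).real {v | linStat (len n) v = n} := by
  have hn' : (0 : ℝ) < n := by exact_mod_cast hn
  have h1 := mul_real_linStat_lt_le (rate w n) (len n) n ((n : ℝ) ^ (-γ)) (by positivity)
    (fun k hk1 hk2 => ⟨⟨k - 1, by omega⟩, by simp only [len]; omega⟩)
    (fun i => by
      rw [len_mul_rate]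
      refine le_trans ?_ (hlow _ (by simp [len]))
      refine Real.rpow_le_rpow_of_nonpos (by simp only [len]; positivity) ?_ (by linarith)
      have := i.2
      simp only [len]
      exact_mod_cast (by omega : (i : ℕ) + 1 ≤ n))
  have h2 := mul_real_le_of_le_linStat (rate w n) (len n) {v | n ≤ linStat (len n) v} n
    (fun v hv => by exact_mod_cast hv)
  have h3 : ∑ i, len n i * rate w n i * (poissonPi (rate w n)).real
      {v | v + Pi.single i 1 ∈ {v : Fin n → ℕ | n ≤ linStat (len n) v}} ≤ (1 - c) * n := by
    refine le_trans ?_ hsum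
    rw [← sum_len n fun j => (w j : ℝ)]
    refine Finset.sum_le_sum fun i _ => ?_
    rw [len_mul_rate]
    exact mul_le_of_le_one_right (by positivity) measureReal_le_one
  have h4 : (poissonPi (rate w n)).real {v | n ≤ linStat (len n) v} ≤ 1 - c := by
    have := h2.trans h3
    rw [mul_comm] at this
    exact le_of_mul_le_mul_right this hn'
  have h5 : c ≤ (poissonPi (rate w n)).real {v | linStat (len n) v < n} := by
    have : {v : Fin n → ℕ | linStat (len n) v < n} = {v | n ≤ linStat (len n) v}ᶜ := by
      ext v; simp
    rw [this, probReal_compl_eq_one_sub (Set.to_countable _).measurableSet]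
    linarith
  have h6 : (n : ℝ) ^ (1 + γ) = n * (n : ℝ) ^ γ := by
    rw [Real.rpow_add hn', Real.rpow_one]
  have h7 : (n : ℝ) ^ γ * (n : ℝ) ^ (-γ) = 1 := by
    rw [← Real.rpow_add hn']; simp
  have h8 := mul_le_mul_of_nonneg_left h1 (by positivity : 0 ≤ (n : ℝ) ^ γ)
  rw [← mul_assoc, h7, one_mul] at h8
  calc c ≤ _ := h5
    _ ≤ _ := h8
    _ = _ := by rw [h6]; ring


lemma tendsto_mul_real_of_le {a b : ℕ → ℝ} (h0 : ∀ m, 0 ≤ a m) (h : ∀ᶠ m in atTop, a m ≤ b m)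
    (hb : Tendsto b atTop (𝓝 0)) : Tendsto a atTop (𝓝 0) :=
  squeeze_zero' (Eventually.of_forall h0) h hb

/-- One big jump: when the weights of long cycles are of order `j ^ (-γ)` and the short cycles
carry a fraction `σ < 1` of the total mass on average, then conditionally on the total there is a
cycle carrying almost all of the remaining fraction `1 - σ`. -/
theorem tendsto_one_big_jump (γ p C σ e : ℝ) (hγ : 0 < γ) (hp : 1 < p) (hC : 0 ≤ C)
    (he : 0 < e) (heσ : e < σ) (heν : 2 * e ≤ 1 - σ)
    (n : ℕ → ℕ) (hn : Tendsto n atTop atTop) (w : ℕ → ℕ → ℝ≥0)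
    (hlow : ∀ᶠ m in atTop, ∀ j : ℕ, 1 ≤ j → (j : ℝ) ^ (-γ) ≤ w m j)
    (hupp : ∀ᶠ m in atTop, ∀ j : ℕ, (n m : ℝ) ^ (1 / p) ≤ j → w m j ≤ C * (j : ℝ) ^ (-γ))
    (hsum : Tendsto (fun m => (∑ j ∈ Finset.Icc 1 (n m),
      if (j : ℝ) < (n m : ℝ) ^ (1 / p) then (w m j : ℝ) else 0) / n m) atTop (𝓝 σ)) :
    Tendsto (fun m => (poissonPi (rate (w m) (n m))).real {v | linStat (len (n m)) v = n m ∧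
        ¬ ((∃ i, v i ≠ 0 ∧ (1 - σ - 2 * e) * n m ≤ len (n m) i) ∧
          ∀ i, v i ≠ 0 → (len (n m) i : ℝ) ≤ (1 - σ + e) * n m)} /
      (poissonPi (rate (w m) (n m))).real {v | linStat (len (n m)) v = n m}) atTop (𝓝 0) := by
  classical
  have hσ : 0 < σ := he.trans heσ
  have hnR : Tendsto (fun m => (n m : ℝ)) atTop atTop := tendsto_natCast_atTop_atTop.comp hn
  have hpos : ∀ᶠ m in atTop, 0 < n m := hn.eventually_gt_atTop 0
  set μ := fun m => poissonPi (rate (w m) (n m)) with hμ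
  set X := fun m => (n m : ℝ) ^ (1 / p) with hX
  have hp0 : 0 < p := by linarith
  have h1p : 1 / p < 1 := (div_lt_one hp0).2 hp
  have hXtop : Tendsto X atTop atTop := (tendsto_rpow_atTop (by positivity)).comp hnR
  have hXn : Tendsto (fun m => X m / n m) atTop (𝓝 0) := by
    have := (tendsto_rpow_neg_atTop (by linarith : 0 < 1 - 1 / p)).comp hnR
    refine this.congr' ?_
    filter_upwards [hpos] with m hm
    have hm' : (0 : ℝ) < n m := by exact_mod_cast hm
    simp only [Function.comp_apply, hX]
    rw [neg_sub, Real.rpow_sub hm', Real.rpow_one]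
  obtain ⟨r, hr⟩ := exists_nat_gt ((1 + γ) / (γ / 2 * (1 / p)))
  have hr' : 1 + γ < r * (γ / 2 * (1 / p)) := (div_lt_iff₀ (by positivity)).1 hr
  have hr0 : 0 < (r : ℝ) := lt_of_le_of_lt (by positivity) hr
  set δ := e / r with hδ
  have hδ0 : 0 < δ := by positivity
  set K := C * (∑' j : ℕ, ((j : ℝ) + 1) ^ (-1 - γ / 2)) with hK
  have hK0 : 0 ≤ K := by positivity
  set S := fun m => ∑ j ∈ Finset.Icc 1 (n m), if (j : ℝ) < X m then (w m j : ℝ) else 0 with hS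
  -- the four exceptional events
  set E1 := fun m =>
    {v : Fin (n m) → ℕ | r ≤ linStat (fun i => if X m ≤ len (n m) i then 1 else 0) v}
    with hE1
  set E2 := fun m => {v : Fin (n m) → ℕ | (σ + e) * n m ≤
    linStat (fun i => if (len (n m) i : ℝ) < X m then len (n m) i else 0) v} with hE2
  set E3 := fun m => {v : Fin (n m) → ℕ |
    (linStat (fun i => if (len (n m) i : ℝ) < X m then len (n m) i else 0) v : ℝ) ≤
      (σ - e) * n m} with hE3
  set E4 := fun m => {v : Fin (n m) → ℕ |
    2 ≤ linStat (fun i => if δ * n m ≤ len (n m) i then 1 else 0) v ∧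
      linStat (len (n m)) v = n m} with hE4
  have hsmall : ∀ m, ∑ i, ((if (len (n m) i : ℝ) < X m then len (n m) i else 0 : ℕ) : ℝ) *
      rate (w m) (n m) i = S m := fun m => sum_len_mul_rate (w m) (n m) fun j => (j : ℝ) < X m
  have hcle : ∀ m, ∀ i : Fin (n m),
      ((if (len (n m) i : ℝ) < X m then len (n m) i else 0 : ℕ) : ℝ) ≤ X m := by
    intro m i
    split_ifs with h
    · exact h.le
    · simp only [Nat.cast_zero, hX]; positivity
  have hX0 : ∀ m, 0 ≤ X m := fun m => by simp only [hX]; positivity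
  have hE1lim : Tendsto (fun m => (n m : ℝ) ^ (1 + γ) * (μ m).real (E1 m)) atTop (𝓝 0) := by
    have hlim : Tendsto (fun m => K ^ r * (n m : ℝ) ^ (-(r * (γ / 2 * (1 / p)) - (1 + γ)))) atTop
        (𝓝 (K ^ r * 0)) :=
      ((tendsto_rpow_neg_atTop (by linarith)).comp hnR).const_mul _
    rw [mul_zero] at hlim
    refine tendsto_mul_real_of_le (fun m => by positivity) ?_ hlim
    filter_upwards [hupp, hpos] with m hm hm0
    have hm' : (0 : ℝ) < n m := by exact_mod_cast hm0
    have h1 := linStat_count_tail (rate (w m) (n m))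
      (fun i => if X m ≤ len (n m) i then 1 else 0) (fun i => by split_ifs <;> simp) r
    have h2 := sum_rate_le (n := n m) hγ hC (by simp only [hX]; positivity : 0 < X m) hm
    have h3 := h1.trans (pow_le_pow_left₀ (by positivity) h2 r)
    calc _ ≤ (n m : ℝ) ^ (1 + γ) * (K * X m ^ (-(γ / 2))) ^ r :=
          mul_le_mul_of_nonneg_left h3 (by positivity)
      _ = _ := by
        rw [mul_pow, hX, ← Real.rpow_natCast (_ ^ _) r, ← Real.rpow_mul hm'.le,
          ← Real.rpow_mul hm'.le, mul_left_comm, ← Real.rpow_add hm']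
        congr 2
        ring
  have hE2lim : Tendsto (fun m => (n m : ℝ) ^ (1 + γ) * (μ m).real (E2 m)) atTop (𝓝 0) := by
    have hlim := (tendsto_rpow_mul_pow_floor (θ := (σ + e / 4) / (σ + e / 2)) (c := e / 2)
      (s := 1 + γ) (by positivity) ((div_lt_one (by positivity)).2 (by linarith)) (by positivity)
      hp).comp hnR
    refine tendsto_mul_real_of_le (fun m => by positivity) ?_ hlim
    filter_upwards [hsum.eventually_lt_const (by linarith : σ < σ + e / 4), hpos] with m hm hm0
    have hm' : (0 : ℝ) < n m := by exact_mod_cast hm0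
    have hSm : S m < (σ + e / 4) * n m := (div_lt_iff₀ hm').1 hm
    have hXm : 0 < X m := by simp only [hX]; positivity
    refine mul_le_mul_of_nonneg_left ?_ (by positivity)
    refine le_trans (measureReal_mono (fun v hv => ?_) (measure_ne_top _ _))
      (linStat_upper_tail (rate (w m) (n m)) _ (X m) ((σ + e / 2) * n m)
        ((σ + e / 4) / (σ + e / 2)) (by positivity) (hcle m) (hX0 m) (by positivity) ?_ _)
    · simp only [hE2, Set.mem_ofPred_eq] at hv
      refine le_trans ?_ hv
      have := Nat.floor_le (show 0 ≤ e / 2 * n m / X m by positivity)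
      have := (le_div_iff₀ hXm).1 this
      simp only [hX] at this ⊢
      linarith
    · rw [hsmall]
      refine hSm.le.trans_eq ?_
      have : σ + e / 2 ≠ 0 := by positivity
      field_simp
  have hE3lim : Tendsto (fun m => (n m : ℝ) ^ (1 + γ) * (μ m).real (E3 m)) atTop (𝓝 0) := by
    have hlim := (tendsto_rpow_mul_pow_floor (θ := (σ - e / 2) / (σ - e / 4)) (c := e / 2)
      (s := 1 + γ) (div_pos (by linarith) (by linarith))
      ((div_lt_one (by linarith)).2 (by linarith)) (by positivity) hp).comp hnR
    refine tendsto_mul_real_of_le (fun m => by positivity) ?_ hlim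
    filter_upwards [hsum.eventually_const_lt (by linarith : σ - e / 4 < σ), hpos] with m hm hm0
    have hm' : (0 : ℝ) < n m := by exact_mod_cast hm0
    have hSm : (σ - e / 4) * n m < S m := (lt_div_iff₀ hm').1 hm
    have hXm : 0 < X m := by simp only [hX]; positivity
    have hσe : 0 < σ - e / 4 := by linarith
    refine mul_le_mul_of_nonneg_left ?_ (by positivity)
    refine le_trans (measureReal_mono (fun v hv => ?_) (measure_ne_top _ _))
      (linStat_lower_tail (rate (w m) (n m)) _ (X m) ((σ - e / 2) * n m)
        ((σ - e / 2) / (σ - e / 4)) (hcle m) (hX0 m)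
        (div_nonneg (by linarith) (by linarith)) ?_ ?_ _)
    · simp only [hE3, Set.mem_ofPred_eq] at hv
      refine le_trans hv ?_
      have := Nat.floor_le (show 0 ≤ e / 2 * n m / X m by positivity)
      have := (le_div_iff₀ hXm).1 this
      simp only [hX] at this ⊢
      linarith
    · rw [hsmall]
      exact lt_trans (by positivity) hSm
    · rw [hsmall]
      calc (σ - e / 2) * n m = (σ - e / 2) / (σ - e / 4) * ((σ - e / 4) * n m) := by
            rw [← mul_assoc, div_mul_cancel₀ _ hσe.ne']
        _ ≤ _ := mul_le_mul_of_nonneg_left hSm.le (div_nonneg (by linarith) hσe.le)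
  have hXδ : ∀ᶠ m in atTop, X m ≤ δ * n m := by
    filter_upwards [hXn.eventually_lt_const hδ0, hpos] with m hm hm0
    have hm' : (0 : ℝ) < n m := by exact_mod_cast hm0
    exact ((div_lt_iff₀ hm').1 hm).le
  have hE4lim : Tendsto (fun m => (n m : ℝ) ^ (1 + γ) * (μ m).real (E4 m)) atTop (𝓝 0) := by
    have hlim : Tendsto (fun m => K * C * δ ^ (-1 - γ) * X m ^ (-(γ / 2))) atTop
        (𝓝 (K * C * δ ^ (-1 - γ) * 0)) :=
      ((tendsto_rpow_neg_atTop (by positivity)).comp hXtop).const_mul _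
    rw [mul_zero] at hlim
    refine tendsto_mul_real_of_le (fun m => by positivity) ?_ hlim
    filter_upwards [hupp, hpos, hXδ] with m hm hm0 hmδ
    have hm' : (0 : ℝ) < n m := by exact_mod_cast hm0
    have h1 := linStat_two_le (rate (w m) (n m))
      (fun i => if δ * n m ≤ len (n m) i then 1 else 0) (len (n m))
      (fun i => by split_ifs <;> simp) (len_injective _) (n m) (C * (δ * n m) ^ (-1 - γ))
      (by positivity) (fun i => by
        split_ifs with hi
        · rw [Nat.cast_one, one_mul]
          refine (rate_le hm i (hmδ.trans hi)).trans (mul_le_mul_of_nonneg_left ?_ hC)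
          exact Real.rpow_le_rpow_of_nonpos (by positivity) hi (by linarith)
        · rw [Nat.cast_zero, zero_mul]; positivity)
    have h2 := sum_rate_le (n := n m) hγ hC (by simp only [hX]; positivity : 0 < X m) hm
    have h3 : ∑ i, ((if δ * n m ≤ len (n m) i then 1 else 0 : ℕ) : ℝ) * rate (w m) (n m) i ≤
        K * X m ^ (-(γ / 2)) := by
      refine le_trans (Finset.sum_le_sum fun i _ =>
        mul_le_mul_of_nonneg_right ?_ (by positivity)) h2
      by_cases hi : δ * n m ≤ (len (n m) i : ℝ)
      · rw [if_pos hi, if_pos (hmδ.trans hi)]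
      · rw [if_neg hi, Nat.cast_zero]; positivity
    calc _ ≤ (n m : ℝ) ^ (1 + γ) * (K * X m ^ (-(γ / 2)) * (C * (δ * n m) ^ (-1 - γ))) := by
          refine mul_le_mul_of_nonneg_left (h1.trans ?_) (by positivity)
          exact mul_le_mul_of_nonneg_right h3 (by positivity)
      _ = K * C * δ ^ (-1 - γ) * X m ^ (-(γ / 2)) *
          ((n m : ℝ) ^ (1 + γ) * (n m : ℝ) ^ (-1 - γ)) := by
          rw [Real.mul_rpow hδ0.le hm'.le]; ring
      _ = _ := by
          rw [← Real.rpow_add hm']; simp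
  have hden : ∀ᶠ m in atTop, (1 - σ) / 2 ≤
      (n m : ℝ) ^ (1 + γ) * (μ m).real {v | linStat (len (n m)) v = n m} := by
    have h1 : Tendsto (fun m => C * X m ^ (-γ)) atTop (𝓝 (C * 0)) :=
      ((tendsto_rpow_neg_atTop hγ).comp hXtop).const_mul _
    have h2 := hsum.add h1
    rw [mul_zero, add_zero] at h2
    filter_upwards [h2.eventually_lt_const (by linarith : σ < 1 - (1 - σ) / 2), hpos, hlow, hupp]
      with m hm hm0 hmlow hmupp
    have hm' : (0 : ℝ) < n m := by exact_mod_cast hm0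
    have hXm : 0 < X m := by simp only [hX]; positivity
    refine le_rpow_mul_real_linStat_eq hm0 hγ hmlow ?_
    have h3 : ∑ j ∈ Finset.Icc 1 (n m), (w m j : ℝ) ≤
        S m + n m * (C * X m ^ (-γ)) := by
      have : (n m : ℝ) * (C * X m ^ (-γ)) = ∑ j ∈ Finset.Icc 1 (n m), C * X m ^ (-γ) := by simp
      rw [this, hS, ← Finset.sum_add_distrib]
      refine Finset.sum_le_sum fun j _ => ?_
      by_cases hj : (j : ℝ) < X m
      · rw [if_pos hj]
        exact le_add_of_nonneg_right (by positivity)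
      · rw [if_neg hj, zero_add]
        refine (hmupp j (not_lt.1 hj)).trans (mul_le_mul_of_nonneg_left ?_ hC)
        exact Real.rpow_le_rpow_of_nonpos hXm (not_lt.1 hj) (by linarith)
    refine h3.trans ?_
    have h4 : (S m / n m + C * X m ^ (-γ)) * n m < (1 - (1 - σ) / 2) * n m :=
      mul_lt_mul_of_pos_right hm hm'
    have h5 : (S m / n m + C * X m ^ (-γ)) * n m = S m + n m * (C * X m ^ (-γ)) := by
      field_simp
    linarith
  have htot := ((hE1lim.add hE2lim).add (hE3lim.add hE4lim)).div_const ((1 - σ) / 2)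
  simp only [add_zero, zero_div] at htot
  refine tendsto_mul_real_of_le (fun m => by positivity) ?_ htot
  filter_upwards [hden, hpos, hXn.eventually_lt_const (by linarith : 0 < 1 - σ + e)]
    with m hm hm0 hmX
  have hm' : (0 : ℝ) < n m := by exact_mod_cast hm0
  have hMle : X m ≤ (1 - σ + e) * n m := ((div_lt_iff₀ hm').1 hmX).le
  have hsub : {v : Fin (n m) → ℕ | linStat (len (n m)) v = n m ∧
        ¬ ((∃ i, v i ≠ 0 ∧ (1 - σ - 2 * e) * n m ≤ len (n m) i) ∧
          ∀ i, v i ≠ 0 → (len (n m) i : ℝ) ≤ (1 - σ + e) * n m)} ⊆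
      (E1 m ∪ E2 m) ∪ (E3 m ∪ E4 m) := by
    rintro v ⟨hv, hv'⟩
    by_contra hcon
    simp only [Set.mem_union, not_or, hE1, hE2, hE3, hE4, Set.mem_ofPred_eq, not_le,
      not_and] at hcon
    obtain ⟨⟨c1, c2⟩, c3, c4⟩ := hcon
    refine hv' (exists_long_of_typical (len (n m)) v (n m) r (X m) (δ * n m) σ e (by positivity) hv
      c1 c3 c2 ?_ ?_ (by linarith) hMle)
    · by_contra h
      exact c4 (not_lt.1 h) hv
    · rw [hδ]
      refine le_of_eq ?_
      field_simp
  have hbound : (μ m).real {v : Fin (n m) → ℕ | linStat (len (n m)) v = n m ∧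
        ¬ ((∃ i, v i ≠ 0 ∧ (1 - σ - 2 * e) * n m ≤ len (n m) i) ∧
          ∀ i, v i ≠ 0 → (len (n m) i : ℝ) ≤ (1 - σ + e) * n m)} ≤
      ((μ m).real (E1 m) + (μ m).real (E2 m)) + ((μ m).real (E3 m) + (μ m).real (E4 m)) :=
    (measureReal_mono hsub (measure_ne_top _ _)).trans
      ((measureReal_union_le _ _).trans
        (add_le_add (measureReal_union_le _ _) (measureReal_union_le _ _)))
  have hNpos : 0 < (n m : ℝ) ^ (1 + γ) := by positivity
  rw [← mul_div_mul_left _ _ hNpos.ne']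
  refine div_le_div₀ (by positivity) ?_ (by linarith) hm
  calc _ ≤ _ := mul_le_mul_of_nonneg_left hbound hNpos.le
    _ = _ := by ring

end BigJump

section CycleCounts

open scoped NNReal

/-- The numbers of cycles of each length of a permutation of `Fin n`. -/
def counts {n : ℕ} (π : Equiv.Perm (Fin n)) (i : Fin n) : ℕ := (cycleLens π).count (len n i)

/-- The multiset of lengths with prescribed multiplicities. -/
def lensOf {n : ℕ} (v : Fin n → ℕ) : Multiset ℕ := ∑ i, Multiset.replicate (v i) (len n i)

lemma count_lensOf {n : ℕ} (v : Fin n → ℕ) (i : Fin n) : (lensOf v).count (len n i) = v i := by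
  simp [lensOf, Multiset.count_sum', Multiset.count_replicate, (len_injective n).eq_iff]

lemma exists_of_mem_lensOf {n : ℕ} {v : Fin n → ℕ} {a : ℕ} (h : a ∈ lensOf v) :
    ∃ i, a = len n i := by
  obtain ⟨i, -, hi⟩ := Multiset.mem_sum.1 h
  exact ⟨i, Multiset.eq_of_mem_replicate hi⟩

lemma sum_lensOf {n : ℕ} (v : Fin n → ℕ) : (lensOf v).sum = linStat (len n) v := by
  simp [lensOf, linStat, Multiset.sum_sum, mul_comm]

lemma prod_map_lensOf {n : ℕ} {M : Type*} [CommMonoid M] (w : ℕ → M) (v : Fin n → ℕ) :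
    ((lensOf v).map w).prod = ∏ i, w (len n i) ^ v i := by
  rw [lensOf, ← Multiset.coe_mapAddMonoidHom, map_sum, Multiset.prod_sum]
  simp

variable {n : ℕ}

lemma exists_len {a : ℕ} (h1 : 1 ≤ a) (h2 : a ≤ n) : ∃ i : Fin n, a = len n i :=
  ⟨⟨a - 1, by omega⟩, by simp [len]; omega⟩

lemma sum_cycleType_le (π : Equiv.Perm (Fin n)) : π.cycleType.sum ≤ n := by
  rw [π.sum_cycleType]; simpa using π.support.card_le_univ

lemma sum_cycleLens (π : Equiv.Perm (Fin n)) : (cycleLens π).sum = n := by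
  have := sum_cycleType_le π
  simp [cycleLens]; omega

lemma one_le_of_mem_cycleLens {π : Equiv.Perm (Fin n)} {a : ℕ} (h : a ∈ cycleLens π) : 1 ≤ a := by
  rcases Multiset.mem_add.1 h with h | h
  · exact (Equiv.Perm.one_lt_of_mem_cycleType h).le
  · exact (Multiset.eq_of_mem_replicate h).ge

lemma le_of_mem_cycleLens {π : Equiv.Perm (Fin n)} {a : ℕ} (h : a ∈ cycleLens π) : a ≤ n :=
  sum_cycleLens π ▸ Multiset.le_sum_of_mem h

lemma lensOf_counts (π : Equiv.Perm (Fin n)) : lensOf (counts π) = cycleLens π := by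
  ext a
  by_cases h : ∃ i : Fin n, a = len n i
  · obtain ⟨i, rfl⟩ := h
    rw [count_lensOf, counts]
  · rw [Multiset.count_eq_zero.2 fun h' => h (exists_of_mem_lensOf h'),
      Multiset.count_eq_zero.2 fun h' =>
        h (exists_len (one_le_of_mem_cycleLens h') (le_of_mem_cycleLens h'))]

lemma linStat_counts (π : Equiv.Perm (Fin n)) : linStat (len n) (counts π) = n := by
  rw [← sum_lensOf, lensOf_counts, sum_cycleLens]

lemma filter_cycleLens (π : Equiv.Perm (Fin n)) :
    (cycleLens π).filter (2 ≤ ·) = π.cycleType := by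
  rw [cycleLens, Multiset.filter_add, Multiset.filter_eq_self.2 fun a ha =>
    Equiv.Perm.two_le_of_mem_cycleType ha, Multiset.filter_eq_nil.2 fun a ha => by
    simp [Multiset.eq_of_mem_replicate ha], add_zero]

lemma lensOf_eq (v : Fin n → ℕ) :
    lensOf v = (lensOf v).filter (2 ≤ ·) + Multiset.replicate ((lensOf v).count 1) 1 := by
  conv_lhs => rw [← Multiset.filter_add_not (2 ≤ ·) (lensOf v)]
  congr 1
  rw [← Multiset.filter_eq']
  refine Multiset.filter_congr fun a ha => ?_
  obtain ⟨i, rfl⟩ := exists_of_mem_lensOf ha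
  simp only [len]; omega

lemma sum_filter_lensOf {v : Fin n → ℕ} (hv : linStat (len n) v = n) :
    ((lensOf v).filter (2 ≤ ·)).sum + (lensOf v).count 1 = n := by
  have h := congrArg Multiset.sum (lensOf_eq v)
  rw [sum_lensOf, hv, Multiset.sum_add] at h
  simpa using h.symm

lemma counts_eq_iff {v : Fin n → ℕ} (hv : linStat (len n) v = n) (π : Equiv.Perm (Fin n)) :
    counts π = v ↔ π.cycleType = (lensOf v).filter (2 ≤ ·) := by
  constructor
  · rintro rfl
    rw [lensOf_counts, filter_cycleLens]
  · intro h
    have h2 : cycleLens π = lensOf v := by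
      have := sum_filter_lensOf hv
      rw [cycleLens, h]
      conv_rhs => rw [lensOf_eq v]
      congr 2
      omega
    funext i
    rw [counts, h2, count_lensOf]

lemma prod_factorial_count_lensOf (v : Fin n → ℕ) :
    ((lensOf v).count 1).factorial *
      ∏ a ∈ ((lensOf v).filter (2 ≤ ·)).toFinset,
        (((lensOf v).filter (2 ≤ ·)).count a).factorial = ∏ i, (v i).factorial := by
  have hle : ∀ a ∈ lensOf v, 1 ≤ a ∧ a ≤ n := fun a ha => by
    obtain ⟨i, rfl⟩ := exists_of_mem_lensOf ha
    simp only [len]; omega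
  have h1 : ∏ i, (v i).factorial = ∏ a ∈ Finset.range (n + 2), ((lensOf v).count a).factorial := by
    have : ∏ i, (v i).factorial =
        ∏ a ∈ Finset.univ.image (len n), ((lensOf v).count a).factorial := by
      rw [Finset.prod_image fun _ _ _ _ h => len_injective n h]
      simp_rw [count_lensOf]
    rw [this]
    refine Finset.prod_subset (fun a ha => ?_) fun a _ ha => ?_
    · obtain ⟨i, -, rfl⟩ := Finset.mem_image.1 ha
      simp only [len, Finset.mem_range]; omega
    · rw [Multiset.count_eq_zero.2, Nat.factorial_zero]
      intro h
      obtain ⟨i, rfl⟩ := exists_of_mem_lensOf h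
      exact ha (Finset.mem_image_of_mem _ (Finset.mem_univ i))
  have h2 : ∏ a ∈ ((lensOf v).filter (2 ≤ ·)).toFinset,
        (((lensOf v).filter (2 ≤ ·)).count a).factorial =
      ∏ a ∈ Finset.range (n + 2), (((lensOf v).filter (2 ≤ ·)).count a).factorial := by
    refine Finset.prod_subset (fun a ha => ?_) fun a _ ha => ?_
    · have := hle a (Multiset.mem_filter.1 (Multiset.mem_toFinset.1 ha)).1
      simp only [Finset.mem_range]; omega
    · rw [Multiset.count_eq_zero.2 (by simpa using ha), Nat.factorial_zero]
  have h3 : ((lensOf v).count 1).factorial =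
      ∏ a ∈ Finset.range (n + 2), if a = 1 then ((lensOf v).count 1).factorial else 1 := by
    simp
  rw [h1, h2, h3, ← Finset.prod_mul_distrib]
  refine Finset.prod_congr rfl fun a _ => ?_
  rw [Multiset.count_filter]
  rcases eq_or_ne a 1 with rfl | ha
  · simp
  · by_cases h : 2 ≤ a
    · simp [h, ha]
    · have : a ∉ lensOf v := fun h' => by have := hle a h'; omega
      simp [h, ha, this]

/-- The number of permutations with given cycle counts (Cauchy's formula). -/
lemma card_counts_eq_mul {v : Fin n → ℕ} (hv : linStat (len n) v = n) :
    (Finset.univ.filter fun π : Equiv.Perm (Fin n) => counts π = v).card *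
      ∏ i, (len n i ^ v i * (v i).factorial) = n.factorial := by
  have h := Equiv.Perm.card_of_cycleType_mul_eq (Fin n) ((lensOf v).filter (2 ≤ ·))
  have hs := sum_filter_lensOf hv
  rw [if_pos ⟨by simp; omega, fun a ha => (Multiset.mem_filter.1 ha).2⟩, Fintype.card_fin] at h
  simp_rw [counts_eq_iff hv, Finset.prod_mul_distrib]
  rw [← h, ← prod_factorial_count_lensOf v]
  have h1 : n - ((lensOf v).filter (2 ≤ ·)).sum = (lensOf v).count 1 := by omega
  have h2 : ∏ i, len n i ^ v i = ((lensOf v).filter (2 ≤ ·)).prod := by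
    have := prod_map_lensOf (fun a => a) v
    rw [Multiset.map_id'] at this
    rw [← this]
    conv_lhs => rw [lensOf_eq v]
    simp
  rw [h1, h2]
  congr 1
  ring

lemma range_counts : Set.range (counts (n := n)) = {v | linStat (len n) v = n} := by
  ext v
  constructor
  · rintro ⟨π, rfl⟩
    exact linStat_counts π
  · intro hv
    have h := card_counts_eq_mul (n := n) (v := v) hv
    by_contra hcon
    rw [Finset.card_eq_zero.2 (Finset.filter_eq_empty_iff.2 fun π _ hπ => hcon ⟨π, hπ⟩),
      zero_mul] at h
    exact (Nat.factorial_pos n).ne h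

open scoped Classical in
/-- Under multiplicative weights, the cycle counts of a random permutation are independent Poisson
variables conditioned on their total size. -/
lemma sum_perm_eq_poisson (w : ℕ → ℝ≥0) (A : Set (Fin n → ℕ)) :
    ∑ π : Equiv.Perm (Fin n), (if counts π ∈ A then ((cycleLens π).map fun j => (w j : ℝ)).prod
      else 0) =
    n.factorial * Real.exp (∑ i, (rate w n i : ℝ)) *
      (poissonPi (rate w n)).real {v | linStat (len n) v = n ∧ v ∈ A} := by
  have hset : {v | linStat (len n) v = n ∧ v ∈ A} =
      (((Finset.univ.image (counts (n := n))).filter (· ∈ A) : Finset (Fin n → ℕ)) :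
        Set (Fin n → ℕ)) := by
    have := range_counts (n := n)
    ext v
    have h2 : linStat (len n) v = n ↔ v ∈ Set.range (counts (n := n)) := by rw [this]; rfl
    simp only [Finset.coe_filter, Set.mem_ofPred_eq, Finset.mem_image, Finset.mem_univ, true_and,
      h2, Set.mem_range]
  rw [hset, ← sum_measureReal_singleton, Finset.mul_sum, Finset.sum_filter,
    ← Finset.sum_fiberwise_of_maps_to (g := counts) (t := Finset.univ.image counts)
      fun π _ => Finset.mem_image_of_mem _ (Finset.mem_univ π)]
  refine Finset.sum_congr rfl fun v hv => ?_
  have hvn : linStat (len n) v = n := by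
    obtain ⟨π, -, rfl⟩ := Finset.mem_image.1 hv
    exact linStat_counts π
  by_cases hA : v ∈ A
  · rw [if_pos hA, poissonPi_real_singleton, Finset.sum_congr rfl (g := fun _ =>
      ∏ i, (w (len n i) : ℝ) ^ v i)]
    · rw [Finset.sum_const, nsmul_eq_mul, ← card_counts_eq_mul hvn]
      push_cast
      rw [Real.exp_neg]
      have : Real.exp (∑ i, (rate w n i : ℝ)) ≠ 0 := (Real.exp_pos _).ne'
      have h3 : ∏ i, (w (len n i) : ℝ) ^ v i = (∏ i, ((len n i : ℝ) ^ v i * (v i).factorial)) *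
          ∏ i, (rate w n i : ℝ) ^ v i / (v i).factorial := by
        rw [← Finset.prod_mul_distrib]
        refine Finset.prod_congr rfl fun i _ => ?_
        have h4 : ((v i).factorial : ℝ) ≠ 0 := by positivity
        have h5 : (w (len n i) : ℝ) = len n i * rate w n i := (len_mul_rate w n i).symm
        rw [h5, mul_pow]
        field_simp
      rw [h3]
      field_simp
      try ring
    · intro π hπ
      obtain ⟨-, rfl⟩ := Finset.mem_filter.1 hπ
      rw [if_pos hA, ← lensOf_counts, prod_map_lensOf]
  · rw [if_neg hA]
    refine Finset.sum_eq_zero fun π hπ => ?_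
    obtain ⟨-, rfl⟩ := Finset.mem_filter.1 hπ
    rw [if_neg hA]

lemma permWeight_eq_prod (α : ℕ → ℝ) (π : Equiv.Perm (Fin n)) :
    permWeight α π = ((cycleLens π).map fun j => Real.exp (-α j)).prod := by
  have hc : ∀ j, cycCount π j = (cycleLens π).count j := by
    intro j
    rw [cycCount, cycleLens, Multiset.count_add, Multiset.count_replicate]
    split_ifs with h h' h'
    · rw [Multiset.count_eq_zero.2, zero_add]
      intro h3
      have := Equiv.Perm.two_le_of_mem_cycleType h3
      omega
    · omega
    · omega
    · simp
  rw [permWeight, ← Finset.sum_neg_distrib, Real.exp_sum, Finset.prod_multiset_map_count]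
  refine Eq.trans ?_ (Finset.prod_subset (s₂ := Finset.Icc 1 n) (fun a ha => ?_)
    fun a _ ha => ?_).symm
  · refine Finset.prod_congr rfl fun j _ => ?_
    rw [hc, ← Real.exp_nat_mul]
    ring_nf
  · have := Multiset.mem_toFinset.1 ha
    exact Finset.mem_Icc.2 ⟨one_le_of_mem_cycleLens this, le_of_mem_cycleLens this⟩
  · rw [Multiset.count_eq_zero.2 (by simpa using ha), pow_zero]

lemma le_ellD {π : Equiv.Perm (Fin n)} {a : ℕ} (h : a ∈ cycleLens π) : a ≤ ellD π 0 := by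
  have hs : ((cycleLens π).sort (· ≤ ·)).reverse.Pairwise (· ≥ ·) :=
    List.pairwise_reverse.2 (Multiset.pairwise_sort _ _)
  have hm : a ∈ ((cycleLens π).sort (· ≤ ·)).reverse := by simpa using h
  rw [ellD]
  generalize ((cycleLens π).sort (· ≤ ·)).reverse = l at hs hm
  cases l with
  | nil => simp at hm
  | cons b l =>
    rcases List.mem_cons.1 hm with rfl | hm
    · simp
    · exact (List.pairwise_cons.1 hs).1 a hm

lemma ellD_mem (hn : 0 < n) (π : Equiv.Perm (Fin n)) : ellD π 0 ∈ cycleLens π := by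
  have h0 : ((cycleLens π).sort (· ≤ ·)).reverse ≠ [] := by
    intro h
    have h1 : cycleLens π = 0 := by
      have := Multiset.sort_eq (cycleLens π) (· ≤ ·)
      rw [← this, List.reverse_eq_nil_iff.1 h]; rfl
    have := sum_cycleLens π
    rw [h1] at this
    simp at this; omega
  have hm : ∀ a, a ∈ ((cycleLens π).sort (· ≤ ·)).reverse → a ∈ cycleLens π := by simp
  rw [ellD]
  generalize ((cycleLens π).sort (· ≤ ·)).reverse = l at h0 hm
  cases l with
  | nil => simp at h0
  | cons b l => exact hm _ (by simp)

/-- The longest cycle is controlled by the cycle counts. -/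
lemma ellD_bounds (hn : 0 < n) {π : Equiv.Perm (Fin n)} {x y : ℝ}
    (h : (∃ i, counts π i ≠ 0 ∧ x ≤ len n i) ∧ ∀ i, counts π i ≠ 0 → (len n i : ℝ) ≤ y) :
    x ≤ ellD π 0 ∧ (ellD π 0 : ℝ) ≤ y := by
  obtain ⟨⟨i, hi, hx⟩, hy⟩ := h
  constructor
  · refine hx.trans (Nat.cast_le.2 (le_ellD ?_))
    exact Multiset.count_ne_zero.1 hi
  · have hm := ellD_mem hn π
    obtain ⟨i, hi⟩ := exists_len (one_le_of_mem_cycleLens hm) (le_of_mem_cycleLens hm)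
    rw [hi]
    exact hy i (Multiset.count_ne_zero.2 (hi ▸ hm))

end CycleCounts

section Lattice

/-- Finite measures on the torus are determined by their Fourier coefficients. -/
lemma ext_of_integral_mFourier {ι : Type*} [Fintype ι] {μ ν : Measure (UnitAddTorus ι)}
    [IsFiniteMeasure μ] [IsFiniteMeasure ν]
    (h : ∀ n, ∫ t, UnitAddTorus.mFourier n t ∂μ = ∫ t, UnitAddTorus.mFourier n t ∂ν) : μ = ν := by
  have hintegral : ∀ (κ : Measure (UnitAddTorus ι)) [IsFiniteMeasure κ] (g : C(UnitAddTorus ι, ℂ)),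
      Integrable g κ := fun κ _ g =>
    .of_bound g.continuous.aestronglyMeasurable ‖g‖ (.of_forall g.norm_coe_le_norm)
  have hcont : ∀ (κ : Measure (UnitAddTorus ι)) [IsFiniteMeasure κ],
      Continuous fun g : C(UnitAddTorus ι, ℂ) => ∫ t, g t ∂κ := by
    intro κ _
    refine (LipschitzWith.of_dist_le_mul (K := (κ.real Set.univ).toNNReal)
      fun g₁ g₂ => ?_).continuous
    rw [dist_eq_norm, ← integral_sub (hintegral κ g₁) (hintegral κ g₂),
      Real.coe_toNNReal _ measureReal_nonneg, dist_eq_norm, mul_comm]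
    exact norm_integral_le_of_norm_le_const (.of_forall (g₁ - g₂).norm_coe_le_norm)
  have hall : ∀ g : C(UnitAddTorus ι, ℂ), ∫ t, g t ∂μ = ∫ t, g t ∂ν := by
    intro g
    have hg : g ∈ closure
        (Submodule.span ℂ (Set.range (UnitAddTorus.mFourier (d := ι))) :
          Set C(UnitAddTorus ι, ℂ)) := by
      rw [← Submodule.topologicalClosure_coe, UnitAddTorus.span_mFourier_closure_eq_top]
      trivial
    refine closure_minimal (fun p hp => ?_) (isClosed_eq (hcont μ) (hcont ν)) hg
    change ∫ t, p t ∂μ = ∫ t, p t ∂ν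
    induction hp using Submodule.span_induction with
    | mem x hx => obtain ⟨n, rfl⟩ := hx; exact h n
    | zero => simp
    | add x y _ _ hx hy =>
      simp only [ContinuousMap.add_apply]
      rw [integral_add (hintegral μ x) (hintegral μ y),
        integral_add (hintegral ν x) (hintegral ν y), hx, hy]
    | smul a x _ hx =>
      simp only [ContinuousMap.smul_apply]
      rw [integral_smul, integral_smul, hx]
  refine ext_of_forall_integral_eq_of_IsFiniteMeasure fun g => ?_
  have := hall ⟨fun t => (g t : ℂ), by fun_prop⟩
  simp only [ContinuousMap.coe_mk] at this
  have h1 : ∀ κ : Measure (UnitAddTorus ι), ∫ t, (g t : ℂ) ∂κ = ((∫ t, g t ∂κ : ℝ) : ℂ) :=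
    fun κ => integral_ofReal
  rw [h1, h1] at this
  exact_mod_cast this

variable {d : ℕ}

@[simp] lemma latPt_apply (L : ℝ) (z : Fin d → ℤ) (i : Fin d) : latPt d L z i = L * z i := rfl

@[simp] lemma dualPt_apply (L : ℝ) (z : Fin d → ℤ) (i : Fin d) : dualPt d L z i = z i / L := rfl

lemma measurableSet_cube (L : ℝ) : MeasurableSet (cube d L) := by
  have : cube d L = ⋂ i, (fun x : Eu d => x i) ⁻¹' Set.Ico 0 L := by ext; simp [cube]
  rw [this]
  exact .iInter fun i => measurableSet_Ico.preimage (by fun_prop)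

lemma sub_latPt_mem_cube_iff {L : ℝ} (hL : 0 < L) (x : Eu d) (z : Fin d → ℤ) :
    x - latPt d L z ∈ cube d L ↔ z = fun i => ⌊x i / L⌋ := by
  simp only [cube, Set.mem_ofPred_eq, Set.mem_Ico, PiLp.sub_apply, latPt_apply, funext_iff]
  refine forall_congr' fun i => ?_
  rw [eq_comm, Int.floor_eq_iff, le_div_iff₀ hL, div_lt_iff₀ hL]
  constructor <;> rintro ⟨h1, h2⟩ <;> constructor <;> nlinarith

/-- Unfolding an integral over the lattice translates of the cube. -/
lemma lintegral_eq_cube_tsum {L : ℝ} (hL : 0 < L) {g : Eu d → ℝ≥0∞} (hg : Measurable g) :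
    ∫⁻ x, g x = ∫⁻ x in cube d L, ∑' z : Fin d → ℤ, g (x - latPt d L z) := by
  have h1 : ∀ x, g x = ∑' z : Fin d → ℤ, (cube d L).indicator (fun _ => g x) (x - latPt d L z) := by
    intro x
    rw [tsum_eq_single (fun i => ⌊x i / L⌋)]
    · rw [Set.indicator_of_mem ((sub_latPt_mem_cube_iff hL _ _).2 rfl)]
    · intro z hz
      rw [Set.indicator_of_notMem (fun h => hz ((sub_latPt_mem_cube_iff hL _ _).1 h))]
  have hm : ∀ z : Fin d → ℤ,
      Measurable fun x => (cube d L).indicator (fun _ => g x) (x - latPt d L z) := by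
    intro z
    exact hg.indicator ((measurableSet_cube L).preimage (measurable_id.sub_const _))
  calc ∫⁻ x, g x
      = ∑' z : Fin d → ℤ, ∫⁻ x, (cube d L).indicator (fun _ => g x) (x - latPt d L z) := by
        rw [← lintegral_tsum fun z => (hm z).aemeasurable]
        exact lintegral_congr h1
    _ = ∑' z : Fin d → ℤ, ∫⁻ x in cube d L, g (x - latPt d L (-z)) := by
        refine tsum_congr fun z => ?_
        rw [← lintegral_add_right_eq_self _ (latPt d L z), ← lintegral_indicator
          (measurableSet_cube L)]
        refine lintegral_congr fun x => ?_
        have : x - latPt d L (-z) = x + latPt d L z := by ext i; simp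
        by_cases hx : x ∈ cube d L
        · rw [Set.indicator_of_mem (by rwa [add_sub_cancel_right]), Set.indicator_of_mem hx, this]
        · rw [Set.indicator_of_notMem (by rwa [add_sub_cancel_right]), Set.indicator_of_notMem hx]
    _ = ∑' z : Fin d → ℤ, ∫⁻ x in cube d L, g (x - latPt d L z) :=
        (Equiv.neg (Fin d → ℤ)).tsum_eq fun z => ∫⁻ x in cube d L, g (x - latPt d L z)
    _ = _ := (lintegral_tsum fun z => (hg.comp (measurable_id.sub_const _)).aemeasurable).symm

/-- The character `x ↦ exp (2πi z·x/L)` of period `L`. -/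
def chi (L : ℝ) (z : Fin d → ℤ) (x : Eu d) : ℂ :=
  ∏ i, Complex.exp (2 * Real.pi * Complex.I * z i * (x i / L))

lemma chi_add_left (L : ℝ) (z z' : Fin d → ℤ) (x : Eu d) :
    chi L (z + z') x = chi L z x * chi L z' x := by
  rw [chi, chi, chi, ← Finset.prod_mul_distrib]
  refine Finset.prod_congr rfl fun i _ => ?_
  rw [← Complex.exp_add]; congr 1; simp; ring

lemma chi_add (L : ℝ) (z : Fin d → ℤ) (x y : Eu d) : chi L z (x + y) = chi L z x * chi L z y := by
  rw [chi, chi, chi, ← Finset.prod_mul_distrib]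
  refine Finset.prod_congr rfl fun i _ => ?_
  rw [← Complex.exp_add]; congr 1; simp; ring

lemma chi_neg (L : ℝ) (z : Fin d → ℤ) (x : Eu d) : chi L z (-x) = chi L (-z) x := by
  simp [chi, neg_div]

lemma chi_neg_left (L : ℝ) (z : Fin d → ℤ) (x : Eu d) :
    chi L (-z) x = (starRingEnd ℂ) (chi L z x) := by
  have : (starRingEnd ℂ) 2 = 2 := Complex.conj_ofNat 2
  simp [chi, ← Complex.exp_conj, this]

@[simp] lemma norm_chi (L : ℝ) (z : Fin d → ℤ) (x : Eu d) : ‖chi L z x‖ = 1 := by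
  rw [chi, norm_prod]
  refine Finset.prod_eq_one fun i _ => ?_
  rw [Complex.norm_exp]
  simp [← Complex.ofReal_div, ← Complex.ofReal_intCast]

lemma continuous_chi (L : ℝ) (z : Fin d → ℤ) : Continuous (chi (d := d) L z) := by
  unfold chi; fun_prop

lemma chi_sub_latPt {L : ℝ} (hL : 0 < L) (z w : Fin d → ℤ) (x : Eu d) :
    chi L z (x - latPt d L w) = chi L z x := by
  rw [chi, chi]
  refine Finset.prod_congr rfl fun i _ => ?_
  have hL' : (L : ℂ) ≠ 0 := by exact_mod_cast hL.ne'
  have : 2 * Real.pi * Complex.I * z i * (x i / L) =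
      2 * Real.pi * Complex.I * z i * (((x - latPt d L w) i : ℝ) / L) +
        (z i * w i : ℤ) * (2 * Real.pi * Complex.I) := by
    simp
    field_simp
    ring
  rw [this, Complex.exp_add, Complex.exp_int_mul_two_pi_mul_I, mul_one]

/-- The projection of `ℝ^d` to the torus. -/
def toTorus (d : ℕ) (L : ℝ) (x : Eu d) : UnitAddTorus (Fin d) :=
  fun i => ((x i / L : ℝ) : AddCircle (1:ℝ))

lemma continuous_toTorus (L : ℝ) : Continuous (toTorus d L) := by
  unfold toTorus
  refine continuous_pi fun i => (AddCircle.continuous_mk' (1:ℝ)).comp ?_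
  fun_prop

lemma mFourier_toTorus (L : ℝ) (z : Fin d → ℤ) (x : Eu d) :
    UnitAddTorus.mFourier z (toTorus d L x) = chi L z x := by
  simp only [UnitAddTorus.mFourier, toTorus, ContinuousMap.coe_mk, chi]
  refine Finset.prod_congr rfl fun i _ => ?_
  rw [fourier_coe_apply]
  push_cast
  simp

lemma injOn_toTorus {L : ℝ} (hL : 0 < L) : Set.InjOn (toTorus d L) (cube d L) := by
  intro x hx y hy h
  ext i
  have h1 := congrFun h i
  have hx' := hx i
  have hy' := hy i
  have hmem : ∀ t ∈ Set.Ico 0 L, t / L ∈ Set.Ico (0:ℝ) (0 + 1) := fun t ht =>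
    ⟨div_nonneg ht.1 hL.le, by rw [zero_add, div_lt_one hL]; exact ht.2⟩
  have h2 := (AddCircle.coe_eq_coe_iff_of_mem_Ico (hmem _ hx') (hmem _ hy')).1 h1
  field_simp at h2
  exact h2

lemma setIntegral_cube_prod (L : ℝ) (h : Fin d → ℝ → ℂ) :
    ∫ x in cube d L, ∏ i, h i (x i) = ∏ i, ∫ t in Set.Ico 0 L, h i t := by
  have hpre : cube d L = (MeasurableEquiv.toLp 2 (Fin d → ℝ)).symm ⁻¹'
      (Set.univ.pi fun _ => Set.Ico 0 L) := by
    ext x; simp [cube]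
  have := (EuclideanSpace.volume_preserving_symm_measurableEquiv_toLp
    (Fin d)).setIntegral_preimage_emb
    (MeasurableEquiv.measurableEmbedding _) (fun y : Fin d → ℝ => ∏ i, h i (y i))
    (Set.univ.pi fun _ => Set.Ico 0 L)
  rw [hpre]
  refine Eq.trans ?_ (this.trans ?_)
  · rfl
  · rw [volume_pi, Measure.restrict_pi_pi, integral_fintype_prod_eq_prod]

/-- Orthogonality of characters. -/
lemma setIntegral_cube_chi {L : ℝ} (hL : 0 < L) (z : Fin d → ℤ) :
    ∫ x in cube d L, chi L z x = if z = 0 then (L : ℂ) ^ d else 0 := by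
  have h1 : ∀ n : ℤ, ∫ t in Set.Ico 0 L,
      Complex.exp (2 * Real.pi * Complex.I * n * ((t : ℂ) / L)) = if n = 0 then (L : ℂ) else 0 := by
    intro n
    split_ifs with hn
    · subst hn
      simp [Real.volume_real_Ico_of_le hL.le]
    · have hL' : (L : ℂ) ≠ 0 := by exact_mod_cast hL.ne'
      have hc : 2 * Real.pi * Complex.I * n / L ≠ 0 := by
        simp [hn, hL', Real.pi_ne_zero]
      rw [integral_Ico_eq_integral_Ioc, ← intervalIntegral.integral_of_le hL.le]
      have : ∀ t : ℝ, 2 * Real.pi * Complex.I * n * ((t : ℂ) / L) =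
          (2 * Real.pi * Complex.I * n / L) * t := fun t => by ring
      simp_rw [this]
      rw [integral_exp_mul_complex hc]
      have h2 : 2 * Real.pi * Complex.I * n / L * L = n * (2 * Real.pi * Complex.I) := by
        field_simp
      rw [h2, Complex.exp_int_mul_two_pi_mul_I]
      simp
  have := setIntegral_cube_prod (d := d) L fun i t =>
    Complex.exp (2 * Real.pi * Complex.I * z i * ((t : ℂ) / L))
  rw [show (fun x : Eu d => chi L z x) = fun x => ∏ i,
    Complex.exp (2 * Real.pi * Complex.I * z i * ((x i : ℂ) / L)) from rfl, this]
  simp_rw [h1]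
  split_ifs with hz
  · subst hz; simp
  · obtain ⟨i, hi⟩ := Function.ne_iff.1 hz
    exact Finset.prod_eq_zero (Finset.mem_univ i) (if_neg hi)

lemma volume_cube {L : ℝ} (hL : 0 < L) : volume (cube d L) = ENNReal.ofReal (L ^ d) := by
  have hpre : cube d L = (MeasurableEquiv.toLp 2 (Fin d → ℝ)).symm ⁻¹'
      (Set.univ.pi fun _ => Set.Ico 0 L) := by
    ext x; simp [cube]
  rw [hpre, (EuclideanSpace.volume_preserving_symm_measurableEquiv_toLp
    (Fin d)).measure_preimage_equiv]
  simp [volume_pi_pi, ENNReal.ofReal_pow hL.le]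

lemma integral_chi_neg_mul {f : Eu d → ℝ} {ε : Eu d → ℝ}
    (hFT : ∀ k : Eu d, 𝓕 (fun x => (f x : ℂ)) k = (Real.exp (-ε k) : ℂ)) (L : ℝ)
    (z : Fin d → ℤ) :
    ∫ x, chi L (-z) x * f x = (Real.exp (-ε (dualPt d L z)) : ℂ) := by
  rw [← hFT, Real.fourier_eq']
  refine integral_congr_ae (.of_forall fun x => ?_)
  simp only [smul_eq_mul]
  congr 1
  rw [chi, ← Complex.exp_sum]
  congr 1
  simp only [PiLp.inner_apply, dualPt_apply, Pi.neg_apply]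
  push_cast
  rw [Finset.mul_sum, Finset.sum_mul]
  refine Finset.sum_congr rfl fun i _ => ?_
  simp
  ring

lemma eps_neg {f : Eu d → ℝ} {ε : Eu d → ℝ}
    (hFT : ∀ k : Eu d, 𝓕 (fun x => (f x : ℂ)) k = (Real.exp (-ε k) : ℂ)) (L : ℝ)
    (z : Fin d → ℤ) :
    Real.exp (-ε (dualPt d L (-z))) = Real.exp (-ε (dualPt d L z)) := by
  have h1 := integral_chi_neg_mul hFT L z
  have h2 := integral_chi_neg_mul hFT L (-z)
  have h3 : ∫ x, chi L (- -z) x * f x = (starRingEnd ℂ) (∫ x, chi L (-z) x * f x) := by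
    rw [← integral_conj]
    refine integral_congr_ae (.of_forall fun x => ?_)
    simp only [map_mul, Complex.conj_ofReal, chi_neg_left L (-z)]
  rw [h2, h1, Complex.conj_ofReal] at h3
  exact_mod_cast h3

end Lattice

section Periodization

variable {d : ℕ}

instance (L : ℝ) : IsFiniteMeasure ((volume : Measure (Eu d)).restrict (cube d L)) := by
  refine ⟨?_⟩
  rw [Measure.restrict_apply_univ]
  rcases lt_or_ge 0 L with hL | hL
  · rw [volume_cube hL]; exact ofReal_lt_top
  · rcases Nat.eq_zero_or_pos d with rfl | hd
    · have : (Set.univ : Set (Eu 0)).Finite := Set.toFinite _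
      exact ((this.subset (Set.subset_univ _)).isCompact).measure_lt_top
    · have : cube d L = ∅ := Set.eq_empty_of_forall_notMem fun x hx => by
        have := hx ⟨0, hd⟩
        exact absurd (this.1.trans_lt this.2) hL.not_gt
      simp [this]

/-- The absolutely convergent trigonometric series with coefficients `c`. -/
def trigSum (L : ℝ) (c : (Fin d → ℤ) → ℝ) (x : Eu d) : ℂ := ∑' z, (c z : ℂ) * chi L z x

variable {L : ℝ} {c : (Fin d → ℤ) → ℝ}

lemma norm_mul_chi (c : (Fin d → ℤ) → ℝ) (z : Fin d → ℤ) (x : Eu d) :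
    ‖(c z : ℂ) * chi L z x‖ = |c z| := by simp

lemma continuous_trigSum (hc : Summable c) : Continuous (trigSum L c) :=
  continuous_tsum (fun z => continuous_const.mul (continuous_chi L z)) hc.abs
    fun z x => (norm_mul_chi c z x).le

lemma norm_trigSum_le (hc : Summable c) (x : Eu d) : ‖trigSum L c x‖ ≤ ∑' z, |c z| := by
  refine tsum_of_norm_bounded hc.abs.hasSum fun z => (norm_mul_chi c z x).le

lemma trigSum_sub_latPt (hL : 0 < L) (w : Fin d → ℤ) (x : Eu d) :
    trigSum L c (x - latPt d L w) = trigSum L c x := by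
  simp_rw [trigSum, chi_sub_latPt hL]

lemma ofReal_re_trigSum (hce : ∀ z, c (-z) = c z) (x : Eu d) :
    ((trigSum L c x).re : ℂ) = trigSum L c x := by
  refine Complex.conj_eq_iff_re.1 ?_
  rw [trigSum, Complex.conj_tsum, ← (Equiv.neg _).tsum_eq]
  refine tsum_congr fun z => ?_
  simp [hce, chi_neg_left]

lemma setIntegral_chi_mul_trigSum (hL : 0 < L) (hc : Summable c) (n : Fin d → ℤ) :
    ∫ x in cube d L, chi L (-n) x * trigSum L c x = (L : ℂ) ^ d * c n := by
  have h1 : ∀ x, chi L (-n) x * trigSum L c x = ∑' z, (c z : ℂ) * chi L (z - n) x := by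
    intro x
    rw [trigSum, ← tsum_mul_left]
    refine tsum_congr fun z => ?_
    rw [sub_eq_add_neg, chi_add_left]; ring
  simp_rw [h1]
  rw [← integral_tsum_of_summable_integral_norm]
  · simp_rw [integral_const_mul, setIntegral_cube_chi hL, sub_eq_zero]
    rw [tsum_eq_single n fun z hz => by simp [hz]]
    simp [mul_comm]
  · intro z
    exact .of_bound (continuous_const.mul (continuous_chi L _)).aestronglyMeasurable |c z|
      (.of_forall fun x => by simp)
  · simp only [norm_mul, norm_chi, mul_one, integral_const, smul_eq_mul, Complex.norm_real,
      Real.norm_eq_abs]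
    exact hc.abs.mul_left _

/-- A measure carried by the cube is determined by its image on the torus. -/
lemma ext_of_map_toTorus (hL : 0 < L) {μ ν : Measure (Eu d)} (hμ : μ (cube d L)ᶜ = 0)
    (hν : ν (cube d L)ᶜ = 0) (h : μ.map (toTorus d L) = ν.map (toTorus d L)) : μ = ν := by
  ext s hs
  have hm : MeasurableSet (toTorus d L '' (s ∩ cube d L)) :=
    (hs.inter (measurableSet_cube L)).image_of_continuousOn_injOn
      (continuous_toTorus L).continuousOn ((injOn_toTorus hL).mono Set.inter_subset_right)
  have hpre : toTorus d L ⁻¹' (toTorus d L '' (s ∩ cube d L)) ∩ cube d L = s ∩ cube d L := by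
    ext x
    constructor
    · rintro ⟨⟨y, hy, hxy⟩, hx⟩
      rwa [← injOn_toTorus hL hy.2 hx hxy]
    · exact fun hx => ⟨⟨x, hx, rfl⟩, hx.2⟩
  have key : ∀ κ : Measure (Eu d), κ (cube d L)ᶜ = 0 →
      κ s = κ.map (toTorus d L) (toTorus d L '' (s ∩ cube d L)) := by
    intro κ hκ
    rw [Measure.map_apply (continuous_toTorus L).measurable hm,
      ← measure_inter_conull hκ, ← measure_inter_conull (s := _ ⁻¹' _) hκ, hpre]
  rw [key μ hμ, key ν hν, h]

lemma toTorus_sub_latPt (hL : 0 < L) (x : Eu d) (z : Fin d → ℤ) :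
    toTorus d L (x - latPt d L z) = toTorus d L x := by
  funext i
  have : (x - latPt d L z) i / L = x i / L - (z i : ℤ) • (1 : ℝ) := by
    simp; field_simp
  rw [toTorus, toTorus, this, AddCircle.coe_sub, AddCircle.coe_zsmul, AddCircle.coe_period]
  simp

lemma map_toTorus_fper (hL : 0 < L) {f : Eu d → ℝ} (hf : Measurable f) :
    ((volume.restrict (cube d L)).withDensity (fper d f L)).map (toTorus d L) =
      (volume.withDensity fun x => ENNReal.ofReal (f x)).map (toTorus d L) := by
  ext s hs
  have hq := (continuous_toTorus (d := d) L).measurable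
  have hqs := hs.preimage hq
  rw [Measure.map_apply hq hs, Measure.map_apply hq hs, withDensity_apply _ hqs,
    withDensity_apply _ hqs, ← lintegral_indicator hqs, ← lintegral_indicator hqs,
    lintegral_eq_cube_tsum hL (hf.ennreal_ofReal.indicator hqs)]
  refine lintegral_congr fun x => ?_
  by_cases hx : toTorus d L x ∈ s
  · rw [Set.indicator_of_mem (by exact hx), fper]
    refine tsum_congr fun z => ?_
    rw [Set.indicator_of_mem (by simpa [toTorus_sub_latPt hL] using hx)]
  · rw [Set.indicator_of_notMem (by exact hx)]
    refine (ENNReal.tsum_eq_zero.2 fun z => ?_).symm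
    rw [Set.indicator_of_notMem (by simpa [toTorus_sub_latPt hL] using hx)]

lemma integral_mFourier_map (n : Fin d → ℤ) (μ : Measure (Eu d)) {g : Eu d → ℝ}
    (hg : Measurable g) :
    ∫ t, UnitAddTorus.mFourier n t ∂((μ.withDensity fun x => ENNReal.ofReal (g x)).map
      (toTorus d L)) = ∫ x, (max (g x) 0 : ℝ) * chi L n x ∂μ := by
  rw [integral_map (continuous_toTorus L).aemeasurable
    (UnitAddTorus.mFourier n).continuous.aestronglyMeasurable,
    integral_withDensity_eq_integral_toReal_smul hg.ennreal_ofReal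
    (.of_forall fun x => ofReal_lt_top)]
  simp [mFourier_toTorus, ENNReal.toReal_ofReal']

/-- The set where a periodic identity fails is null as soon as it is null in the cube. -/
lemma ae_of_ae_cube (hL : 0 < L) {s : Set (Eu d)} (hs : MeasurableSet s)
    (hper : ∀ x z, x - latPt d L z ∈ s ↔ x ∈ s) (h : ∀ᵐ x ∂volume.restrict (cube d L), x ∈ s) :
    ∀ᵐ x, x ∈ s := by
  rw [ae_iff] at h ⊢
  change volume sᶜ = 0
  rw [← lintegral_indicator_one hs.compl,
    lintegral_eq_cube_tsum hL (measurable_one.indicator hs.compl)]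
  refine lintegral_eq_zero_of_ae_eq_zero ?_
  filter_upwards [ae_iff.2 h] with x hx
  refine ENNReal.tsum_eq_zero.2 fun z => ?_
  rw [Set.indicator_of_notMem]
  simpa [hper] using hx

lemma fper_sub_latPt (f : Eu d → ℝ) (x : Eu d) (w : Fin d → ℤ) :
    fper d f L (x - latPt d L w) = fper d f L x := by
  rw [fper, fper, ← (Equiv.addLeft w).tsum_eq fun z => ENNReal.ofReal (f (x - latPt d L z))]
  refine tsum_congr fun z => ?_
  congr 2
  ext i
  simp; ring

/-- The periodization of `f` is the trigonometric series with coefficients `|Λ|⁻¹ e^{-ε}`. -/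
lemma fper_eq_ofReal_trigSum {f ε : Eu d → ℝ} (hf_cont : Continuous f) (hf_nonneg : ∀ x, 0 ≤ f x)
    (hf_int : Integrable f) (hFT : ∀ k : Eu d, 𝓕 (fun x => (f x : ℂ)) k = (Real.exp (-ε k) : ℂ))
    (hL : 0 < L) (hper : Continuous (fper d f L))
    (hsum : Summable fun z => Real.exp (-ε (dualPt d L z))) (x : Eu d) :
    fper d f L x =
        ENNReal.ofReal (trigSum L (fun z => (L ^ d)⁻¹ * Real.exp (-ε (dualPt d L z))) x).re ∧
      0 ≤ (trigSum L (fun z => (L ^ d)⁻¹ * Real.exp (-ε (dualPt d L z))) x).re := by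
  set c : (Fin d → ℤ) → ℝ := fun z => (L ^ d)⁻¹ * Real.exp (-ε (dualPt d L z)) with hcdef
  have hc : Summable c := hsum.mul_left _
  have hce : ∀ z, c (-z) = c z := fun z => by simp only [hcdef, eps_neg hFT]
  set G : Eu d → ℝ := fun x => (trigSum L c x).re with hG
  have hGc : Continuous G := Complex.continuous_re.comp (continuous_trigSum hc)
  have hGb : ∀ x, |G x| ≤ ∑' z, |c z| := fun x =>
    (Complex.abs_re_le_norm _).trans (norm_trigSum_le hc x)
  set R : Measure (Eu d) := volume.restrict (cube d L) with hR
  have hfin : ∀ g : Eu d → ℝ, Continuous g → (∀ x, |g x| ≤ ∑' z, |c z|) →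
      IsFiniteMeasure (R.withDensity fun x => ENNReal.ofReal (g x)) := fun g hg hb =>
    isFiniteMeasure_withDensity_ofReal
      (Integrable.of_bound hg.aestronglyMeasurable _ (.of_forall hb)).2
  have := hfin G hGc hGb
  have := hfin (fun x => - G x) hGc.neg (by simpa using hGb)
  have : IsFiniteMeasure (volume.withDensity fun x => ENNReal.ofReal (f x)) :=
    isFiniteMeasure_withDensity_ofReal hf_int.2
  have hmap : (volume.withDensity fun x => ENNReal.ofReal (f x)).map (toTorus d L) +
      (R.withDensity fun x => ENNReal.ofReal (-G x)).map (toTorus d L) =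
      (R.withDensity fun x => ENNReal.ofReal (G x)).map (toTorus d L) := by
    refine ext_of_integral_mFourier fun n => ?_
    have hintegral : ∀ g : Eu d → ℝ, Continuous g → (∀ x, |g x| ≤ ∑' z, |c z|) →
        Integrable (fun x => ((max (g x) 0 : ℝ) : ℂ) * chi L n x) R := fun g hg hb =>
      .of_bound ((Complex.continuous_ofReal.comp (hg.max continuous_const)).mul
        (continuous_chi L n)).aestronglyMeasurable (∑' z, |c z|) (.of_forall fun x => by
          rw [norm_mul, norm_chi, mul_one, Complex.norm_real, Real.norm_eq_abs]
          refine le_trans ?_ (hb x)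
          rw [abs_of_nonneg (le_max_right _ _)]
          exact max_le (le_abs_self _) (abs_nonneg _))
    have hmi : ∀ (κ : Measure (UnitAddTorus (Fin d))) [IsFiniteMeasure κ],
        Integrable (UnitAddTorus.mFourier n) κ := fun κ _ =>
      .of_bound (UnitAddTorus.mFourier n).continuous.aestronglyMeasurable _
        (.of_forall (UnitAddTorus.mFourier n).norm_coe_le_norm)
    rw [integral_add_measure (hmi _) (hmi _), integral_mFourier_map n volume hf_cont.measurable,
      integral_mFourier_map n R (g := fun x => -G x) hGc.neg.measurable,
      integral_mFourier_map n R hGc.measurable,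
      ← eq_sub_iff_add_eq, ← integral_sub (hintegral _ hGc hGb)
        (hintegral (fun x => -G x) hGc.neg (by simpa using hGb))]
    have h1 : ∀ x, ((max (G x) 0 : ℝ) : ℂ) * chi L n x - ((max (-G x) 0 : ℝ) : ℂ) * chi L n x =
        chi L (- -n) x * trigSum L c x := by
      intro x
      rw [← ofReal_re_trigSum hce x, ← sub_mul, neg_neg, mul_comm]
      congr 1
      rw [← Complex.ofReal_sub]
      congr 1
      rcases le_total (G x) 0 with h | h
      · rw [max_eq_right h, max_eq_left (by linarith)]; ring
      · rw [max_eq_left h, max_eq_right (by linarith)]; ring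
    simp_rw [h1]
    rw [setIntegral_chi_mul_trigSum hL hc, hce]
    have h2 := integral_chi_neg_mul hFT L (-n)
    rw [neg_neg, eps_neg hFT] at h2
    simp_rw [max_eq_left (hf_nonneg _), mul_comm _ (chi L n _), h2, hcdef]
    have : (L : ℂ) ≠ 0 := by exact_mod_cast hL.ne'
    push_cast
    field_simp
  have hae : (fun x => fper d f L x + ENNReal.ofReal (-G x)) =ᵐ[R]
      fun x => ENNReal.ofReal (G x) := by
    rw [← map_toTorus_fper hL hf_cont.measurable,
      ← Measure.map_add _ _ (continuous_toTorus L).measurable,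
      ← withDensity_add_left hper.measurable] at hmap
    have h0 : ∀ g : Eu d → ℝ≥0∞, (R.withDensity g) (cube d L)ᶜ = 0 := fun g =>
      withDensity_absolutelyContinuous R g (by
        rw [hR, Measure.restrict_apply (measurableSet_cube L).compl]; simp)
    exact (withDensity_eq_iff_of_sigmaFinite (hper.measurable.add
      hGc.neg.measurable.ennreal_ofReal).aemeasurable hGc.measurable.ennreal_ofReal.aemeasurable).1
      (ext_of_map_toTorus hL (h0 _) (h0 _) hmap)
  have hGper : ∀ x z, G (x - latPt d L z) = G x := fun x z => by
    simp only [hG, trigSum_sub_latPt hL]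
  have hc1 : Continuous fun x => fper d f L x + ENNReal.ofReal (-G x) :=
    hper.add (ENNReal.continuous_ofReal.comp hGc.neg)
  have hc2 : Continuous fun x => ENNReal.ofReal (G x) := ENNReal.continuous_ofReal.comp hGc
  have hev := (Continuous.ae_eq_iff_eq (μ := (volume : Measure (Eu d))) hc1 hc2).1
    (ae_of_ae_cube hL (s := {x | fper d f L x + ENNReal.ofReal (-G x) = ENNReal.ofReal (G x)})
      (measurableSet_eq_fun hc1.measurable hc2.measurable)
      (fun x z => by simp only [Set.mem_ofPred_eq, fper_sub_latPt, hGper]) hae)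
  have hx := congrFun hev x
  rcases le_or_gt 0 (G x) with h | h
  · rw [ENNReal.ofReal_of_nonpos (neg_nonpos.2 h), add_zero] at hx
    exact ⟨hx, h⟩
  · rw [ENNReal.ofReal_of_nonpos h.le] at hx
    have := (add_eq_zero.1 hx).2
    rw [ENNReal.ofReal_eq_zero] at this
    linarith

end Periodization

section CycleFactorization

lemma summable_prod_pi {ι Z 𝕜 : Type*} [Fintype ι] [Countable Z] [RCLike 𝕜]
    {g : ι → Z → 𝕜} (hg : ∀ i, Summable fun z => ‖g i z‖) :
    (Summable fun k : ι → Z => ‖∏ i, g i (k i)‖) ∧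
      ∑' k : ι → Z, ∏ i, g i (k i) = ∏ i, ∑' z, g i z := by
  let : MeasurableSpace Z := ⊤
  have hms : MeasurableSingletonClass Z := ⟨fun _ => trivial⟩
  have hcount : Measure.pi (fun _ : ι => (Measure.count : Measure Z)) = Measure.count := by
    refine Measure.ext_of_singleton fun k => ?_
    rw [Measure.pi_singleton]
    simp
  have hi : Integrable (fun k : ι → Z => ∏ i, g i (k i)) Measure.count := by
    rw [← hcount]
    exact Integrable.fintype_prod fun i => integrable_count_iff.2 (hg i).of_norm.norm
  have htsum : ∀ {Y : Type _} [MeasurableSpace Y] [MeasurableSingletonClass Y] [Countable Y]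
      (F : Y → 𝕜), Integrable F Measure.count → ∫ y, F y ∂Measure.count = ∑' y, F y := by
    intro Y _ _ _ F hF
    rw [integral_countable hF]
    simp [measureReal_def]
  refine ⟨integrable_count_iff.1 hi, ?_⟩
  rw [← htsum _ hi, ← hcount, integral_fintype_prod_eq_prod]
  refine Finset.prod_congr rfl fun i _ => ?_
  exact integral_countable (integrable_count_iff.2 (hg i).of_norm.norm) |>.trans
    (by simp [measureReal_def])

variable {n : ℕ} (π : Equiv.Perm (Fin n))

/-- The cycles of a permutation, fixed points included. -/
abbrev CycleQuot : Type := Quotient (Equiv.Perm.SameCycle.setoid π)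

instance : Fintype (CycleQuot π) := Fintype.ofFinite _

lemma mk_eq_mk_iff {i j : Fin n} :
    (Quotient.mk _ i : CycleQuot π) = Quotient.mk _ j ↔ π.SameCycle i j := Quotient.eq

lemma sameCycle_out (i : Fin n) : π.SameCycle (Quotient.mk _ i : CycleQuot π).out i :=
  (mk_eq_mk_iff π).1 (Quotient.out_eq _)

open scoped Classical in
lemma card_fiber_of_moved {q : CycleQuot π} (hq : π q.out ≠ q.out) :
    (Finset.univ.filter fun i => (Quotient.mk _ i : CycleQuot π) = q).card =
      (π.cycleOf q.out).support.card := by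
  congr 1
  ext i
  rw [Equiv.Perm.mem_support_cycleOf_iff' hq, Finset.mem_filter_univ]
  conv_lhs => rw [← Quotient.out_eq q]
  rw [mk_eq_mk_iff]
  exact Equiv.Perm.sameCycle_comm

open scoped Classical in
lemma card_fiber_of_fixed {q : CycleQuot π} (hq : π q.out = q.out) :
    (Finset.univ.filter fun i => (Quotient.mk _ i : CycleQuot π) = q).card = 1 := by
  rw [Finset.card_eq_one]
  refine ⟨q.out, ?_⟩
  ext i
  rw [Finset.mem_filter_univ, Finset.mem_singleton]
  conv_lhs => rw [← Quotient.out_eq q]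
  rw [mk_eq_mk_iff]
  constructor
  · intro h
    exact (h.symm.eq_of_left hq).symm
  · rintro rfl
    exact Equiv.Perm.SameCycle.refl _ _

open scoped Classical in
lemma prod_cycleQuot {M : Type*} [CommMonoid M] (S : ℕ → M) :
    ∏ q : CycleQuot π, S (Finset.univ.filter fun i => (Quotient.mk _ i : CycleQuot π) = q).card =
      ((cycleLens π).map S).prod := by
  rw [← Finset.prod_filter_mul_prod_filter_not Finset.univ fun q : CycleQuot π => π q.out ≠ q.out,
    cycleLens, Multiset.map_add, Multiset.prod_add]
  congr 1
  · rw [Equiv.Perm.cycleType_def, Multiset.map_map]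
    change _ = ∏ c ∈ π.cycleFactorsFinset, _
    refine Finset.prod_bij (fun q _ => π.cycleOf q.out) (fun q hq => ?_) (fun q hq q' hq' h => ?_)
      (fun c hc => ?_) fun q hq => ?_
    · rw [Equiv.Perm.cycleOf_mem_cycleFactorsFinset_iff, Equiv.Perm.mem_support]
      exact (Finset.mem_filter.1 hq).2
    · have h1 := (Equiv.Perm.sameCycle_iff_cycleOf_eq_of_mem_support
        (Equiv.Perm.mem_support.2 (Finset.mem_filter.1 hq).2)
        (Equiv.Perm.mem_support.2 (Finset.mem_filter.1 hq').2)).2 h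
      rw [← Quotient.out_eq q, ← Quotient.out_eq q']
      exact (mk_eq_mk_iff π).2 h1
    · obtain ⟨a, ha⟩ := ((Equiv.Perm.mem_cycleFactorsFinset_iff.1 hc).1).nonempty_support
      have h1 := Equiv.Perm.cycle_is_cycleOf ha hc
      have h2 : π.cycleOf (Quotient.mk _ a : CycleQuot π).out = c := by
        rw [h1, (sameCycle_out π a).cycleOf_eq]
      refine ⟨Quotient.mk _ a, Finset.mem_filter.2 ⟨Finset.mem_univ _, ?_⟩, h2⟩
      rw [← Equiv.Perm.mem_support, ← Equiv.Perm.cycleOf_mem_cycleFactorsFinset_iff, h2]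
      exact hc
    · rw [card_fiber_of_moved π (Finset.mem_filter.1 hq).2]
      rfl
  · rw [Multiset.map_replicate, Multiset.prod_replicate, Finset.prod_congr rfl (g := fun _ => S 1)
      fun q hq => by rw [card_fiber_of_fixed π (not_not.1 (Finset.mem_filter.1 hq).2)],
      Finset.prod_const]
    congr 1
    have h1 : n - π.cycleType.sum = (Finset.univ.filter fun i => π i = i).card := by
      have : (Finset.univ.filter fun i => π i = i) = π.supportᶜ := by ext; simp
      rw [this, Finset.card_compl, Fintype.card_fin, Equiv.Perm.sum_cycleType]
    rw [h1]
    refine (Finset.card_bij (fun i _ => (Quotient.mk _ i : CycleQuot π)) (fun i hi => ?_)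
      (fun i hi j hj h => ?_) fun q hq => ?_).symm
    · have := (sameCycle_out π i).symm.eq_of_left (Finset.mem_filter.1 hi).2
      rw [Finset.mem_filter, not_not, ← this]
      exact ⟨Finset.mem_univ _, (Finset.mem_filter.1 hi).2⟩
    · exact ((mk_eq_mk_iff π).1 h).eq_of_left (Finset.mem_filter.1 hi).2
    · exact ⟨q.out, Finset.mem_filter.2 ⟨Finset.mem_univ _,
        not_not.1 (Finset.mem_filter.1 hq).2⟩, Quotient.out_eq q⟩

open scoped Classical in
/-- Summing a product weight over the functions that are constant on cycles. -/
lemma tsum_invariant {Z : Type*} [Countable Z] {a : Z → ℝ} (ha0 : ∀ z, 0 ≤ a z)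
    (ha1 : ∀ z, a z ≤ 1) (ha : Summable a) :
    ∑' k : Fin n → Z, (if ∀ i, k (π i) = k i then ∏ i, a (k i) else 0) =
      ((cycleLens π).map fun j => ∑' z, a z ^ j).prod := by
  have hinj : Function.Injective
      fun (φ : CycleQuot π → Z) (i : Fin n) => φ (Quotient.mk _ i) := by
    intro φ ψ h
    funext q
    rw [← Quotient.out_eq q]
    exact congrFun h q.out
  rw [← hinj.tsum_eq]
  · have h1 : ∀ φ : CycleQuot π → Z,
        (if ∀ i, φ (Quotient.mk _ (π i)) = φ (Quotient.mk _ i) then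
          ∏ i, a (φ (Quotient.mk _ i)) else 0) =
        ∏ q, a (φ q) ^ (Finset.univ.filter fun i => (Quotient.mk _ i : CycleQuot π) = q).card := by
      intro φ
      rw [if_pos fun i => congrArg φ ((mk_eq_mk_iff π).2
        (Equiv.Perm.sameCycle_apply_left.2 (Equiv.Perm.SameCycle.refl _ _))),
        ← Finset.prod_fiberwise Finset.univ fun i => (Quotient.mk _ i : CycleQuot π)]
      refine Finset.prod_congr rfl fun q _ => ?_
      rw [Finset.prod_congr rfl (g := fun _ => a (φ q)) fun i hi => by
        rw [(Finset.mem_filter.1 hi).2], Finset.prod_const]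
    simp_rw [h1]
    rw [← prod_cycleQuot π fun j => ∑' z, a z ^ j]
    refine (summable_prod_pi (g := fun (q : CycleQuot π) z =>
      a z ^ (Finset.univ.filter fun i => (Quotient.mk _ i : CycleQuot π) = q).card)
      fun q => ?_).2
    refine ha.of_nonneg_of_le (fun _ => norm_nonneg _) fun z => ?_
    rw [Real.norm_of_nonneg (pow_nonneg (ha0 z) _)]
    refine pow_le_of_le_one (ha0 z) (ha1 z) (Finset.card_ne_zero.2 ⟨q.out, ?_⟩)
    simp
  · intro k hk
    have hk' : ∀ i, k (π i) = k i := by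
      by_contra h
      simp [h] at hk
    have hpow : ∀ (m : ℕ) i, k ((π ^ m) i) = k i := by
      intro m
      induction m with
      | zero => simp
      | succ m ih => intro i; rw [pow_succ', Equiv.Perm.mul_apply, hk', ih]
    refine ⟨fun q => k q.out, funext fun i => ?_⟩
    obtain ⟨m, hm⟩ := (sameCycle_out π i).exists_nat_pow_eq
    change k _ = k i
    have h := hpow m (Quotient.mk _ i : CycleQuot π).out
    rw [hm] at h
    exact h.symm

end CycleFactorization

section GibbsWeight

variable {d : ℕ} {L : ℝ} {c : (Fin d → ℤ) → ℝ}

open scoped Classical in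
lemma integral_prod_trigSum (hL : 0 < L) (hc : Summable c) {n : ℕ} (π : Equiv.Perm (Fin n)) :
    ∫ x, ∏ i, trigSum L c (x i - x (π i))
        ∂Measure.pi (fun _ : Fin n => (volume : Measure (Eu d)).restrict (cube d L)) =
      ∑' k : Fin n → Fin d → ℤ,
        if ∀ i, k (π i) = k i then ∏ i, ((L ^ d * c (k i) : ℝ) : ℂ) else 0 := by
  set R : Measure (Eu d) := volume.restrict (cube d L) with hR
  have hsum := summable_prod_pi (ι := Fin n) (𝕜 := ℝ) (g := fun _ z => c z) fun _ => hc.norm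
  have h1 : ∀ x : Fin n → Eu d, ∏ i, trigSum L c (x i - x (π i)) =
      ∑' k : Fin n → Fin d → ℤ, ∏ i, ((c (k i) : ℂ) * chi L (k i) (x i - x (π i))) := by
    intro x
    refine (summable_prod_pi (g := fun (i : Fin n) z => (c z : ℂ) * chi L z (x i - x (π i)))
      fun i => ?_).2.symm
    simpa using hc.abs
  have h2 : ∀ (k : Fin n → Fin d → ℤ) (x : Fin n → Eu d),
      ∏ i, ((c (k i) : ℂ) * chi L (k i) (x i - x (π i))) =
      (∏ i, (c (k i) : ℂ)) * ∏ i, chi L (k i - k (π⁻¹ i)) (x i) := by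
    intro k x
    rw [Finset.prod_mul_distrib]
    congr 1
    simp_rw [sub_eq_add_neg, chi_add, chi_neg, chi_add_left, Finset.prod_mul_distrib]
    congr 1
    rw [← Equiv.prod_comp π fun i => chi L (-k (π⁻¹ i)) (x i)]
    simp
  have hn : ∀ (k : Fin n → Fin d → ℤ) (x : Fin n → Eu d),
      ‖∏ i, ((c (k i) : ℂ) * chi L (k i) (x i - x (π i)))‖ = ‖∏ i, c (k i)‖ := by
    intro k x
    simp
  simp_rw [h1]
  rw [← integral_tsum_of_summable_integral_norm]
  · refine tsum_congr fun k => ?_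
    simp_rw [h2]
    rw [integral_const_mul, integral_fintype_prod_eq_prod]
    simp_rw [hR, setIntegral_cube_chi hL, sub_eq_zero]
    split_ifs with hk
    · have hk' : ∀ i, k i = k (π⁻¹ i) := fun i => by
        have := hk (π⁻¹ i)
        simpa using this
      simp_rw [if_pos (hk' _)]
      rw [← Finset.prod_mul_distrib]
      refine Finset.prod_congr rfl fun i _ => ?_
      push_cast; ring
    · push Not at hk
      obtain ⟨i, hi⟩ := hk
      have h0 : ∏ i, (if k i = k (π⁻¹ i) then (L : ℂ) ^ d else 0) = 0 :=
        Finset.prod_eq_zero (Finset.mem_univ (π i)) (if_neg (by simpa using hi))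
      rw [h0, mul_zero]
  · intro k
    refine .of_bound (C := ‖∏ i, c (k i)‖) ?_ (.of_forall fun x => (hn k x).le)
    refine Continuous.aestronglyMeasurable (continuous_finsetProd _ fun i _ => ?_)
    exact continuous_const.mul ((continuous_chi L _).comp (by fun_prop))
  · simp_rw [hn, integral_const, smul_eq_mul]
    exact hsum.1.mul_left _

/-- The Gibbs weight of a permutation factorizes over its cycles. -/
lemma toReal_gibbsW {f ε : Eu d → ℝ} (α : ℕ → ℝ) (hf_cont : Continuous f)
    (hf_nonneg : ∀ x, 0 ≤ f x) (hf_int : Integrable f)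
    (hFT : ∀ k : Eu d, 𝓕 (fun x => (f x : ℂ)) k = (Real.exp (-ε k) : ℂ))
    (hε : ∀ k, 0 ≤ ε k) (hL : 0 < L) (hper : Continuous (fper d f L))
    (hsum : Summable fun z => Real.exp (-ε (dualPt d L z))) {n : ℕ} (π : Equiv.Perm (Fin n)) :
    (gibbsW d f α L n π).toReal = ((cycleLens π).map fun j : ℕ =>
      Real.exp (-α j) * ∑' z, Real.exp (-(j * ε (dualPt d L z)))).prod := by
  set c : (Fin d → ℤ) → ℝ := fun z => (L ^ d)⁻¹ * Real.exp (-ε (dualPt d L z)) with hcdef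
  have hc : Summable c := hsum.mul_left _
  have hce : ∀ z, c (-z) = c z := fun z => by simp only [hcdef, eps_neg hFT]
  have hG := fper_eq_ofReal_trigSum hf_cont hf_nonneg hf_int hFT hL hper hsum
  rw [← hcdef] at hG
  have hGc : Continuous fun x => (trigSum L c x).re :=
    Complex.continuous_re.comp (continuous_trigSum hc)
  have hprod : ∀ x : Fin n → Eu d, ∏ i, fper d f L (x i - x (π i)) =
      ENNReal.ofReal (∏ i, (trigSum L c (x i - x (π i))).re) := by
    intro x
    rw [ENNReal.ofReal_prod_of_nonneg fun i _ => (hG _).2]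
    exact Finset.prod_congr rfl fun i _ => (hG _).1
  rw [gibbsW, ENNReal.toReal_mul, ENNReal.toReal_ofReal
    (show 0 ≤ permWeight α π from (Real.exp_pos _).le), permWeight_eq_prod,
    Multiset.prod_map_mul]
  congr 1
  simp_rw [hprod]
  rw [← integral_eq_lintegral_of_nonneg_ae (.of_forall fun x => Finset.prod_nonneg fun i _ =>
      (hG _).2) (Continuous.aestronglyMeasurable (continuous_finsetProd _ fun i _ =>
      hGc.comp (by fun_prop))), volume_pi, Measure.restrict_pi_pi]
  have h3 := integral_prod_trigSum hL hc π
  have h4 := tsum_invariant π (a := fun z => Real.exp (-ε (dualPt d L z)))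
    (fun z => (Real.exp_pos _).le) (fun z => Real.exp_le_one_iff.2 (by simpa using hε _)) hsum
  have hLd : (L ^ d : ℝ) ≠ 0 := by positivity
  have h5 : ∀ z, L ^ d * c z = Real.exp (-ε (dualPt d L z)) := fun z => by
    simp only [hcdef]; field_simp
  have h6 : ∀ x : Fin n → Eu d, ∏ i, trigSum L c (x i - x (π i)) =
      ((∏ i, (trigSum L c (x i - x (π i))).re : ℝ) : ℂ) := by
    intro x
    push_cast
    exact Finset.prod_congr rfl fun i _ => (ofReal_re_trigSum hce _).symm
  simp_rw [h6] at h3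
  have h7 : ∫ x, ((∏ i, (trigSum L c (x i - x (π i))).re : ℝ) : ℂ)
      ∂Measure.pi (fun _ : Fin n => (volume : Measure (Eu d)).restrict (cube d L)) =
      ((∫ x, ∏ i, (trigSum L c (x i - x (π i))).re
      ∂Measure.pi (fun _ : Fin n => (volume : Measure (Eu d)).restrict (cube d L)) : ℝ) : ℂ) :=
    integral_ofReal
  rw [h7] at h3
  have h8 : (∑' k : Fin n → Fin d → ℤ,
        if ∀ i, k (π i) = k i then ∏ i, ((L ^ d * c (k i) : ℝ) : ℂ) else 0) =
      ((∑' k : Fin n → Fin d → ℤ, (if ∀ i, k (π i) = k i then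
        ∏ i, Real.exp (-ε (dualPt d L (k i))) else 0) : ℝ) : ℂ) := by
    rw [Complex.ofReal_tsum]
    refine tsum_congr fun k => ?_
    simp_rw [h5]
    split_ifs <;> simp
  rw [h8] at h3
  refine (Complex.ofReal_injective h3).trans (.trans ?_ (h4.trans ?_))
  · congr!
  congr 1
  refine Multiset.map_congr rfl fun j _ => tsum_congr fun z => ?_
  rw [← Real.exp_nat_mul]
  congr 1; ring

end GibbsWeight

section Integrability

variable {d : ℕ}

lemma integral_gaussian_mul_eq {f : Eu d → ℝ} (hf : Integrable f) {c : ℝ} (hc : 0 < c) :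
    ∫ k : Eu d, Complex.exp (-c⁻¹ * ‖k‖ ^ 2) * 𝓕 (fun x => (f x : ℂ)) k =
      ∫ w : Eu d, ((Real.pi * c : ℂ) ^ (Module.finrank ℝ (Eu d) / 2 : ℂ) *
        Complex.exp (-Real.pi ^ 2 * c * ‖(0 : Eu d) - w‖ ^ 2)) • (f w : ℂ) := by
  have hJ : Integrable (fun w : Eu d => Complex.exp (-c⁻¹ * ‖w‖ ^ 2)) := by
    simpa using GaussianFourier.integrable_cexp_neg_mul_sq_norm_add (V := Eu d) (b := (c⁻¹ : ℂ))
      (by norm_cast; positivity) 0 0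
  have hfc : Integrable fun x => (f x : ℂ) := hf.ofReal
  have h := VectorFourier.integral_fourierIntegral_smul_eq_flip (L := innerₗ (Eu d))
      Real.continuous_fourierChar continuous_inner hJ hfc
  have h2 : ∫ w : Eu d, 𝓕 (fun v : Eu d => Complex.exp (-c⁻¹ * ‖v‖ ^ 2)) w • (f w : ℂ) =
      ∫ k : Eu d, Complex.exp (-c⁻¹ * ‖k‖ ^ 2) * 𝓕 (fun x => (f x : ℂ)) k := by
    simpa using! h
  rw [← h2]
  refine integral_congr_ae (.of_forall fun w => ?_)
  have h3 := fourier_gaussian_innerProductSpace (V := Eu d) (b := ((c⁻¹ : ℝ) : ℂ))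
    (by norm_cast; positivity) w
  simp only [h3]
  rw [smul_eq_mul, smul_eq_mul]
  congr 2
  · simp
  · simp; ring_nf

/-- A continuous integrable function with nonnegative Fourier transform has an integrable
Fourier transform. -/
lemma integrable_exp_neg_of_fourier {f ε : Eu d → ℝ} (hf_cont : Continuous f) (hf : Integrable f)
    (hFT : ∀ k : Eu d, 𝓕 (fun x => (f x : ℂ)) k = (Real.exp (-ε k) : ℂ))
    (hε : ∀ k, 0 ≤ ε k) (hεc : Continuous fun k => Real.exp (-ε k)) :
    Integrable fun k => Real.exp (-ε k) := by
  have hfc : Integrable fun x => (f x : ℂ) := hf.ofReal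
  have hlim := Real.tendsto_integral_gaussian_smul' hfc (v := 0)
    (Complex.continuous_ofReal.comp hf_cont).continuousAt
  set G : ℝ → Eu d → ℝ := fun c k => Real.exp (-c⁻¹ * ‖k‖ ^ 2) * Real.exp (-ε k) with hG
  have hG0 : ∀ c k, 0 ≤ G c k := fun c k => by positivity
  have hGi : ∀ c > 0, Integrable (G c) := by
    intro c hc
    have hJ : Integrable (fun w : Eu d => Complex.exp (-c⁻¹ * ‖w‖ ^ 2)) := by
      simpa using GaussianFourier.integrable_cexp_neg_mul_sq_norm_add (V := Eu d) (b := (c⁻¹ : ℂ))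
        (by norm_cast; positivity) 0 0
    refine hJ.norm.mono' (Continuous.aestronglyMeasurable (by fun_prop)) (.of_forall fun k => ?_)
    rw [Real.norm_of_nonneg (hG0 c k), Complex.norm_exp]
    have : (-((c⁻¹ : ℝ) : ℂ) * (‖k‖:ℂ) ^ 2).re = -c⁻¹ * ‖k‖ ^ 2 := by norm_cast
    rw [this]
    exact mul_le_of_le_one_right (Real.exp_pos _).le (Real.exp_le_one_iff.2 (by simpa using hε k))
  have hGlim : Tendsto (fun c => ∫ k, G c k) atTop (𝓝 (f 0)) := by
    have h1 : Tendsto (fun c => ((∫ k, G c k : ℝ) : ℂ)) atTop (𝓝 (f 0 : ℂ)) := by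
      refine hlim.congr' ?_
      filter_upwards [Ioi_mem_atTop 0] with c hc
      rw [← integral_complex_ofReal]
      refine (integral_gaussian_mul_eq hf hc).symm.trans
        (integral_congr_ae (.of_forall fun k => ?_))
      simp only [hFT, hG]
      push_cast
      rfl
    exact (Complex.continuous_re.tendsto _).comp h1
  refine ⟨hεc.aestronglyMeasurable, ?_⟩
  have hpt : ∀ k, Tendsto (fun c => ENNReal.ofReal (G c k)) atTop
      (𝓝 (ENNReal.ofReal (Real.exp (-ε k)))) := by
    intro k
    refine ENNReal.tendsto_ofReal ?_
    have : Tendsto (fun c : ℝ => Real.exp (-c⁻¹ * ‖k‖ ^ 2)) atTop (𝓝 (Real.exp (-0 * ‖k‖ ^ 2))) :=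
      (Real.continuous_exp.tendsto _).comp (tendsto_inv_atTop_zero.neg.mul_const _)
    simpa [hG] using this.mul_const (Real.exp (-ε k))
  have hfatou := lintegral_liminf_le' (μ := (volume : Measure (Eu d))) (u := (atTop : Filter ℝ))
    (f := fun c k => ENNReal.ofReal (G c k))
    fun c => (Continuous.aemeasurable (by fun_prop)).ennreal_ofReal
  simp_rw [fun k => (hpt k).liminf_eq] at hfatou
  have h2 : Tendsto (fun c => ∫⁻ k, ENNReal.ofReal (G c k)) atTop (𝓝 (ENNReal.ofReal (f 0))) := by
    refine (ENNReal.tendsto_ofReal hGlim).congr' ?_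
    filter_upwards [Ioi_mem_atTop 0] with c hc
    exact ofReal_integral_eq_lintegral_ofReal (hGi c hc) (.of_forall (hG0 c))
  rw [h2.liminf_eq] at hfatou
  rw [hasFiniteIntegral_iff_ofReal (.of_forall fun k => (Real.exp_pos _).le)]
  exact hfatou.trans_lt ofReal_lt_top

end Integrability

section LatticeSums

variable {d : ℕ}

lemma exp_neg_le_rpow {p x : ℝ} (hp : 0 < p) (hx : 0 < x) : Real.exp (-x) ≤ p ^ p * x ^ (-p) := by
  have h1 : (x / p) ^ p ≤ Real.exp x := by
    have h2 : x / p ≤ Real.exp (x / p) := by linarith [Real.add_one_le_exp (x / p)]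
    calc (x / p) ^ p ≤ Real.exp (x / p) ^ p := Real.rpow_le_rpow (by positivity) h2 hp.le
      _ = Real.exp x := by rw [← Real.exp_mul]; congr 1; field_simp
  rw [Real.div_rpow hx.le hp.le, div_le_iff₀ (by positivity)] at h1
  rw [Real.exp_neg, Real.rpow_neg hx.le, inv_le_iff_one_le_mul₀ (Real.exp_pos _)]
  have h3 : 0 < x ^ p := by positivity
  calc (1 : ℝ) = x ^ p * (x ^ p)⁻¹ := (mul_inv_cancel₀ h3.ne').symm
    _ ≤ (Real.exp x * p ^ p) * (x ^ p)⁻¹ := by gcongr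
    _ = _ := by ring

lemma sum_range_rpow_neg_le {t : ℝ} (ht0 : 0 < t) (ht1 : t < 1) (M : ℕ) :
    ∑ n ∈ Finset.range M, ((n : ℝ) + 1) ^ (-t) ≤ (M : ℝ) ^ (1 - t) / (1 - t) := by
  have h1 : 0 < 1 - t := by linarith
  induction M with
  | zero => simp; positivity
  | succ M ih =>
    rw [Finset.sum_range_succ]
    push_cast
    have hM : (0 : ℝ) < M + 1 := by positivity
    have hi : ((M : ℝ) + 1)⁻¹ ≤ 1 := inv_le_one_of_one_le₀ (by simp)
    have h2 : (1 + -((M : ℝ) + 1)⁻¹) ^ (1 - t) ≤ 1 + (1 - t) * -((M : ℝ) + 1)⁻¹ :=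
      rpow_one_add_le_one_add_mul_self (neg_le_neg hi) h1.le (by linarith)
    have h3 : (M : ℝ) = (M + 1) * (1 + -((M : ℝ) + 1)⁻¹) := by
      field_simp; ring
    have h5 : ((M : ℝ) + 1) ^ (1 - t) * ((M : ℝ) + 1)⁻¹ = ((M : ℝ) + 1) ^ (-t) := by
      rw [← Real.rpow_neg_one, ← Real.rpow_add hM]; congr 1; ring
    have h6 : (M : ℝ) ^ (1 - t) ≤
        ((M : ℝ) + 1) ^ (1 - t) - (1 - t) * ((M : ℝ) + 1) ^ (-t) := by
      calc (M : ℝ) ^ (1 - t) = ((M : ℝ) + 1) ^ (1 - t) * (1 + -((M : ℝ) + 1)⁻¹) ^ (1 - t) := by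
            conv_lhs => rw [h3]
            exact Real.mul_rpow hM.le (by linarith)
        _ ≤ ((M : ℝ) + 1) ^ (1 - t) * (1 + (1 - t) * -((M : ℝ) + 1)⁻¹) := by gcongr
        _ = _ := by rw [← h5]; ring
    rw [le_div_iff₀ h1] at ih ⊢
    linarith

lemma sum_prod_max_rpow_le {t L : ℝ} (ht0 : 0 < t) (ht1 : t < 1) (hL : 1 ≤ L) :
    ∑ z ∈ Fintype.piFinset fun _ : Fin d => Finset.Icc (-(⌊L⌋₊ : ℤ)) ⌊L⌋₊,
        ∏ i, (max |(z i : ℝ)| 1) ^ (-t) ≤ ((1 + 2 / (1 - t)) * L ^ (1 - t)) ^ d := by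
  rw [← Finset.prod_univ_sum (fun _ : Fin d => Finset.Icc (-(⌊L⌋₊ : ℤ)) ⌊L⌋₊)
    (fun _ (n : ℤ) => (max |(n : ℝ)| 1) ^ (-t)), Finset.prod_const, Finset.card_univ,
    Fintype.card_fin]
  have h1 : 0 < 1 - t := by linarith
  refine pow_le_pow_left₀ (Finset.sum_nonneg fun _ _ => by positivity) ?_ d
  rw [Finset.sum_Icc_of_even_eq_range (fun n => by simp)]
  have h2 := sum_range_rpow_neg_le ht0 ht1 ⌊L⌋₊
  have h3 : (⌊L⌋₊ : ℝ) ^ (1 - t) ≤ L ^ (1 - t) :=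
    Real.rpow_le_rpow (by positivity) (Nat.floor_le (by linarith)) h1.le
  have h4 : (1 : ℝ) ≤ L ^ (1 - t) := Real.one_le_rpow hL h1.le
  have h5 : ∀ n : ℕ, max |(((n + 1 : ℕ) : ℤ) : ℝ)| 1 = (n : ℝ) + 1 := fun n => by
    rw [max_eq_left] <;> push_cast <;> rw [abs_of_nonneg (by positivity)]; simp
  have h6 : (⌊L⌋₊ : ℝ) ^ (1 - t) / (1 - t) ≤ L ^ (1 - t) / (1 - t) := by gcongr
  rw [Finset.sum_range_succ']
  simp_rw [h5]
  simp only [Nat.cast_zero, Int.cast_zero, abs_zero, zero_le_one, sup_of_le_right, Real.one_rpow,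
    nsmul_eq_mul, Nat.cast_ofNat]
  calc _ ≤ 2 * (L ^ (1 - t) / (1 - t)) + 1 := by linarith
    _ ≤ 2 * (L ^ (1 - t) / (1 - t)) + L ^ (1 - t) := by linarith
    _ = _ := by ring

end LatticeSums

section DispersionSums

variable {d : ℕ} {ε : Eu d → ℝ}

/-- `∑_{k ∈ Λ*} e^{-jε(k)}`. -/
def latSum (ε : Eu d → ℝ) (L : ℝ) (j : ℕ) : ℝ :=
  ∑' z : Fin d → ℤ, Real.exp (-(j * ε (dualPt d L z)))

lemma latSum_nonneg (L : ℝ) (j : ℕ) : 0 ≤ latSum ε L j := tsum_nonneg fun _ => (Real.exp_pos _).le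

lemma summable_exp_mul (hε : ∀ k, 0 ≤ ε k) {L : ℝ}
    (hsum : Summable fun z => Real.exp (-ε (dualPt d L z))) {j : ℕ} (hj : 1 ≤ j) :
    Summable fun z => Real.exp (-(j * ε (dualPt d L z))) := by
  refine hsum.of_nonneg_of_le (fun _ => (Real.exp_pos _).le) fun z => Real.exp_le_exp.2 ?_
  have hj' : (1 : ℝ) ≤ j := by exact_mod_cast hj
  nlinarith [hε (dualPt d L z)]

lemma max_le_norm_dualPt {L : ℝ} (hL : 0 < L) {z : Fin d → ℤ} (hz : z ≠ 0) (i : Fin d) :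
    max |(z i : ℝ)| 1 ≤ ‖dualPt d L z‖ * L := by
  have h : ∀ i, |(z i : ℝ)| ≤ ‖dualPt d L z‖ * L := by
    intro i
    have := PiLp.norm_apply_le (dualPt d L z) i
    rwa [dualPt_apply, Real.norm_eq_abs, abs_div, abs_of_pos hL, div_le_iff₀ hL] at this
  refine max_le (h i) ?_
  obtain ⟨i, hi⟩ := Function.ne_iff.1 hz
  refine le_trans ?_ (h i)
  exact_mod_cast Int.one_le_abs hi

lemma norm_dualPt_rpow_neg_le {L s : ℝ} (hd : 1 ≤ d) (hL : 0 < L) (hs : 0 < s) {z : Fin d → ℤ}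
    (hz : z ≠ 0) : (‖dualPt d L z‖ * L) ^ (-s) ≤ ∏ i, (max |(z i : ℝ)| 1) ^ (-(s / d)) := by
  have hd' : (d : ℝ) ≠ 0 := by positivity
  have h0 : 0 ≤ ‖dualPt d L z‖ * L := by positivity
  calc (‖dualPt d L z‖ * L) ^ (-s) = ∏ _i : Fin d, (‖dualPt d L z‖ * L) ^ (-(s / d)) := by
        rw [Finset.prod_const, Finset.card_univ, Fintype.card_fin, ← Real.rpow_mul_natCast h0]
        congr 1; field_simp
    _ ≤ _ := Finset.prod_le_prod (fun _ _ => by positivity) fun i _ =>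
        Real.rpow_le_rpow_of_nonpos (by positivity) (max_le_norm_dualPt hL hz i)
          (neg_nonpos.2 (by positivity))

/-- The polynomial bound on the lattice sums, away from the zero mode. -/
lemma exists_latSum_le (hd : 1 ≤ d) (hε : ∀ k, 0 ≤ ε k)
    (hε_low : ∃ a > (0:ℝ), ∃ η : ℝ, 0 < η ∧ η < d ∧ ∀ k : Eu d, ‖k‖ ≤ 1 → a * ‖k‖ ^ η ≤ ε k)
    (hε_pos : ∀ δ : ℝ, 0 < δ → ∃ c > (0:ℝ), ∀ k : Eu d, δ ≤ ‖k‖ → c ≤ ε k)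
    {I : ℝ} (hRiemann : Tendsto (fun L : ℝ => (L ^ d)⁻¹ * ∑' z, Real.exp (-ε (dualPt d L z)))
      atTop (𝓝 I))
    (hsum : ∀ᶠ L in atTop, Summable fun z => Real.exp (-ε (dualPt d L z))) :
    ∃ p : ℝ, 1 < p ∧ ∃ C : ℝ, 0 ≤ C ∧ ∀ᶠ L : ℝ in atTop, ∀ j : ℕ, 1 ≤ j →
      latSum ε L j ≤ 1 + C * (j : ℝ) ^ (-p) * L ^ d := by
  obtain ⟨a, ha, η, hη0, hηd, hlow⟩ := hε_low
  obtain ⟨c, hc, hfar⟩ := hε_pos 1 one_pos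
  have hd0 : (0 : ℝ) < d := by positivity
  obtain ⟨p, hp1, hpη⟩ := exists_between ((one_lt_div hη0).2 hηd)
  have hp0 : 0 < p := by linarith
  have hs : η * p < d := by rwa [lt_div_iff₀ hη0, mul_comm] at hpη
  have ht1 : η * p / d < 1 := (div_lt_one hd0).2 hs
  have ht0 : 0 < η * p / d := by positivity
  set t := η * p / d with ht
  set K := 1 + 2 / (1 - t) with hK
  have h1t : 0 < 1 - t := by linarith
  have hK0 : 0 < K := by positivity
  set C1 := p ^ p * a ^ (-p) * K ^ d with hC1
  set C2 := p ^ p * Real.exp c * c ^ (-p) * (|I| + 1) with hC2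
  have hC1p : 0 ≤ C1 := by positivity
  have hC2p : 0 ≤ C2 := by positivity
  refine ⟨p, hp1, C1 + C2, by positivity, ?_⟩
  have hR : ∀ᶠ L : ℝ in atTop,
      (L ^ d)⁻¹ * ∑' z, Real.exp (-ε (dualPt d L z)) ≤ |I| + 1 :=
    hRiemann.eventually_le_const (by linarith [le_abs_self I])
  filter_upwards [hR, hsum, eventually_ge_atTop 1] with L hR hsum hL j hj
  have hL0 : 0 < L := by linarith
  have hLd : 0 < L ^ d := by positivity
  have hj0 : (0 : ℝ) < j := by exact_mod_cast hj
  set F := Fintype.piFinset fun _ : Fin d => Finset.Icc (-(⌊L⌋₊ : ℤ)) ⌊L⌋₊ with hF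
  set b : (Fin d → ℤ) → ℝ := fun z => p ^ p * a ^ (-p) * (j : ℝ) ^ (-p) * L ^ (η * p) *
    ∏ i, (max |(z i : ℝ)| 1) ^ (-t) with hb
  have hb0 : ∀ z, 0 ≤ b z := fun z => by
    have : 0 ≤ ∏ i, (max |(z i : ℝ)| 1) ^ (-t) := Finset.prod_nonneg fun i _ => by positivity
    positivity
  have hnear : ∀ z : Fin d → ℤ, z ≠ 0 → ‖dualPt d L z‖ ≤ 1 →
      Real.exp (-(j * ε (dualPt d L z))) ≤ b z := by
    intro z hz hz1
    have hk : 0 < ‖dualPt d L z‖ * L := by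
      obtain ⟨i, hi⟩ := Function.ne_iff.1 hz
      exact lt_of_lt_of_le (by positivity) (max_le_norm_dualPt hL0 hz i)
    have hk0 : 0 < ‖dualPt d L z‖ := pos_of_mul_pos_left hk hL0.le
    calc Real.exp (-(j * ε (dualPt d L z))) ≤ Real.exp (-(j * (a * ‖dualPt d L z‖ ^ η))) := by
          have := hlow _ hz1
          gcongr
      _ ≤ p ^ p * (j * (a * ‖dualPt d L z‖ ^ η)) ^ (-p) := exp_neg_le_rpow hp0 (by positivity)
      _ = p ^ p * a ^ (-p) * (j : ℝ) ^ (-p) * L ^ (η * p) *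
          (‖dualPt d L z‖ * L) ^ (-(η * p)) := by
          rw [Real.mul_rpow hj0.le (by positivity), Real.mul_rpow ha.le (by positivity),
            Real.mul_rpow hk0.le hL0.le, ← Real.rpow_mul hk0.le, mul_neg, Real.rpow_neg hL0.le]
          field_simp
      _ ≤ b z := by
          have := norm_dualPt_rpow_neg_le hd hL0 (s := η * p) (by positivity) hz
          exact mul_le_mul_of_nonneg_left this (by positivity)
  have hpt : ∀ z : Fin d → ℤ, Real.exp (-(j * ε (dualPt d L z))) ≤
      ((if z = 0 then 1 else 0) + if z ∈ F then b z else 0) +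
      Real.exp (-((j - 1) * c)) * Real.exp (-ε (dualPt d L z)) := by
    intro z
    have hlast : 0 ≤ Real.exp (-((j - 1) * c)) * Real.exp (-ε (dualPt d L z)) := by positivity
    have hmid : 0 ≤ if z ∈ F then b z else 0 := by split_ifs <;> simp [hb0]
    by_cases hz : z = 0
    · have : Real.exp (-(j * ε (dualPt d L z))) ≤ 1 :=
        Real.exp_le_one_iff.2 (by have := mul_nonneg hj0.le (hε (dualPt d L z)); linarith)
      rw [if_pos hz]; linarith
    rw [if_neg hz, zero_add]
    rcases le_or_gt ‖dualPt d L z‖ 1 with h | h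
    · have hzF : z ∈ F := by
        rw [hF, Fintype.mem_piFinset]
        intro i
        have h2 := (le_max_left _ _).trans (max_le_norm_dualPt hL0 hz i)
        have h3 : |(z i : ℝ)| ≤ L := h2.trans (mul_le_of_le_one_left hL0.le h)
        have h4 : (z i).natAbs ≤ ⌊L⌋₊ := Nat.le_floor (by rw [Nat.cast_natAbs]; exact_mod_cast h3)
        rw [Finset.mem_Icc]; omega
      rw [if_pos hzF]
      linarith [hnear z hz h]
    · have h2 := hfar _ h.le
      have : Real.exp (-(j * ε (dualPt d L z))) ≤
          Real.exp (-((j - 1) * c)) * Real.exp (-ε (dualPt d L z)) := by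
        rw [← Real.exp_add]
        refine Real.exp_le_exp.2 ?_
        have hj1 : (0 : ℝ) ≤ j - 1 := by rw [sub_nonneg]; exact_mod_cast hj
        nlinarith
      linarith
  have hs0 : HasSum (fun z : Fin d → ℤ => if z = 0 then (1 : ℝ) else 0) 1 := hasSum_ite_eq 0 1
  have hs1 : HasSum (fun z => if z ∈ F then b z else 0) (∑ z ∈ F, b z) := by
    rw [Finset.sum_congr rfl fun z (hz : z ∈ F) => (if_pos hz).symm]
    exact hasSum_sum_of_ne_finset_zero fun z hz => if_neg hz
  have hs2 := hsum.hasSum.mul_left (Real.exp (-((j - 1) * c)))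
  have hle := hasSum_le hpt (summable_exp_mul hε hsum hj).hasSum ((hs0.add hs1).add hs2)
  refine hle.trans ?_
  have hnearsum : ∑ z ∈ F, b z ≤ C1 * (j : ℝ) ^ (-p) * L ^ d := by
    have h1 := sum_prod_max_rpow_le (d := d) ht0 ht1 hL
    have h2 : L ^ (η * p) * (L ^ (1 - t)) ^ d = L ^ d := by
      rw [← Real.rpow_mul_natCast hL0.le, ← Real.rpow_add hL0, ← Real.rpow_natCast]
      congr 1
      rw [ht]; field_simp; ring
    rw [← Finset.mul_sum]
    calc _ ≤ p ^ p * a ^ (-p) * (j : ℝ) ^ (-p) * L ^ (η * p) * (K * L ^ (1 - t)) ^ d := by gcongr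
      _ = C1 * (j : ℝ) ^ (-p) * (L ^ (η * p) * (L ^ (1 - t)) ^ d) := by rw [hC1, mul_pow]; ring
      _ = _ := by rw [h2]
  have hfarsum : Real.exp (-((j - 1) * c)) * ∑' z, Real.exp (-ε (dualPt d L z)) ≤
      C2 * (j : ℝ) ^ (-p) * L ^ d := by
    have h1 : ∑' z, Real.exp (-ε (dualPt d L z)) ≤ (|I| + 1) * L ^ d := by
      rwa [inv_mul_le_iff₀ hLd, mul_comm] at hR
    have h2 : Real.exp (-((j - 1) * c)) ≤ Real.exp c * (p ^ p * (j * c) ^ (-p)) := by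
      calc _ = Real.exp c * Real.exp (-(j * c)) := by rw [← Real.exp_add]; congr 1; ring
        _ ≤ _ := by
          have := exp_neg_le_rpow hp0 (x := j * c) (by positivity)
          gcongr
    calc _ ≤ Real.exp c * (p ^ p * (j * c) ^ (-p)) * ((|I| + 1) * L ^ d) := by
          gcongr
      _ = _ := by rw [Real.mul_rpow hj0.le hc.le, hC2]; ring
  linarith

end DispersionSums

section RiemannSums

variable {d : ℕ} {ε : Eu d → ℝ}

/-- The point of the dual lattice at the corner of the cell containing `k`. -/
def cellPt (d : ℕ) (L : ℝ) (k : Eu d) : Eu d := dualPt d L fun i => ⌊k i * L⌋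

lemma measurable_cellPt (L : ℝ) : Measurable (cellPt d L) := by
  refine (MeasurableEquiv.toLp 2 (Fin d → ℝ)).measurable.comp (measurable_pi_lambda _ fun i => ?_)
  exact ((measurable_from_top (f := fun n : ℤ => (n : ℝ))).comp
    (Int.measurable_floor.comp (by fun_prop))).div_const L

lemma tendsto_floor_mul_div (a : ℝ) : Tendsto (fun L : ℝ => (⌊a * L⌋ : ℝ) / L) atTop (𝓝 a) := by
  have h1 : Tendsto (fun L : ℝ => a - L⁻¹) atTop (𝓝 a) := by
    simpa using tendsto_inv_atTop_zero.const_sub a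
  refine tendsto_of_tendsto_of_tendsto_of_le_of_le' h1 tendsto_const_nhds ?_ ?_
  · filter_upwards [eventually_gt_atTop 0] with L hL
    rw [le_div_iff₀ hL, sub_mul, inv_mul_cancel₀ hL.ne']
    exact (Int.sub_one_lt_floor _).le
  · filter_upwards [eventually_gt_atTop 0] with L hL
    rw [div_le_iff₀ hL]
    exact Int.floor_le _

lemma tendsto_cellPt (k : Eu d) : Tendsto (fun L => cellPt d L k) atTop (𝓝 k) := by
  have h : Tendsto (fun L : ℝ => fun i => (⌊k i * L⌋ : ℝ) / L) atTop (𝓝 (WithLp.ofLp k)) :=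
    tendsto_pi_nhds.2 fun i => tendsto_floor_mul_div (k i)
  exact ((PiLp.continuous_toLp 2 (fun _ : Fin d => ℝ)).tendsto _).comp h

/-- Lattice sums are integrals of step functions. -/
lemma lintegral_cellPt {L : ℝ} (hL : 0 < L) {g : Eu d → ℝ≥0∞} (hg : Measurable g) :
    ∫⁻ k, g (cellPt d L k) = ENNReal.ofReal (L ^ d)⁻¹ * ∑' z : Fin d → ℤ, g (dualPt d L z) := by
  have hL' : 0 < L⁻¹ := inv_pos.2 hL
  refine (lintegral_eq_cube_tsum hL' (hg.comp (measurable_cellPt L))).trans ?_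
  have h1 : ∀ x ∈ cube d L⁻¹, ∑' z : Fin d → ℤ, (g ∘ cellPt d L) (x - latPt d L⁻¹ z) =
      ∑' z : Fin d → ℤ, g (dualPt d L z) := by
    intro x hx
    rw [← (Equiv.neg (Fin d → ℤ)).tsum_eq fun z => g (dualPt d L z)]
    refine tsum_congr fun z => ?_
    simp only [Function.comp, cellPt, Equiv.neg_apply]
    congr 2
    funext i
    have hxi := hx i
    rw [Int.floor_eq_iff]
    have h2 : (x - latPt d L⁻¹ z) i * L = x i * L - z i := by
      simp; field_simp
    rw [h2]
    have h3 : 0 ≤ x i * L := mul_nonneg hxi.1 hL.le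
    have h4 : x i * L < 1 := by
      have := mul_lt_mul_of_pos_right hxi.2 hL
      rwa [inv_mul_cancel₀ hL.ne'] at this
    simp only [Pi.neg_apply]; push_cast
    constructor <;> linarith
  rw [setLIntegral_congr_fun (measurableSet_cube _) h1, setLIntegral_const, volume_cube hL',
    inv_pow,
    mul_comm]

lemma integrable_cellPt {L : ℝ} (hL : 0 < L) {g : Eu d → ℝ} (hg : Measurable g) (hg0 : ∀ k, 0 ≤ g k)
    (hs : Summable fun z => g (dualPt d L z)) :
    Integrable (fun k => g (cellPt d L k)) ∧
      ∫ k, g (cellPt d L k) = (L ^ d)⁻¹ * ∑' z, g (dualPt d L z) := by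
  have h1 := lintegral_cellPt hL hg.ennreal_ofReal
  have h0 : 0 ≤ (L ^ d)⁻¹ := by positivity
  rw [← ENNReal.ofReal_tsum_of_nonneg (fun _ => hg0 _) hs, ← ENNReal.ofReal_mul h0] at h1
  have hm := (hg.comp (measurable_cellPt L)).aestronglyMeasurable (μ := volume)
  refine ⟨⟨hm, ?_⟩, ?_⟩
  · rw [hasFiniteIntegral_iff_ofReal (.of_forall fun k => hg0 _), h1]
    exact ofReal_lt_top
  · rw [integral_eq_lintegral_of_nonneg_ae (.of_forall fun k => hg0 _) hm, h1,
      ENNReal.toReal_ofReal (mul_nonneg h0 (tsum_nonneg fun _ => hg0 _))]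

lemma tendsto_latSum (hε : ∀ k, 0 ≤ ε k) (hεc : Continuous fun k => Real.exp (-ε k))
    (hεi : Integrable fun k => Real.exp (-ε k))
    (hRiemann : Tendsto (fun L : ℝ => (L ^ d)⁻¹ * ∑' z, Real.exp (-ε (dualPt d L z)))
      atTop (𝓝 (∫ k, Real.exp (-ε k))))
    (hsum : ∀ᶠ L in atTop, Summable fun z => Real.exp (-ε (dualPt d L z))) {j : ℕ} (hj : 1 ≤ j) :
    Tendsto (fun L : ℝ => (L ^ d)⁻¹ * latSum ε L j) atTop
      (𝓝 (∫ k, Real.exp (-(j * ε k)))) := by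
  set g : Eu d → ℝ := fun k => Real.exp (-ε k) with hg
  have hg0 : ∀ k, 0 ≤ g k := fun k => (Real.exp_pos _).le
  have hg1 : ∀ k, g k ≤ 1 := fun k => Real.exp_le_one_iff.2 (by simpa using hε k)
  have hgm : Measurable g := hεc.measurable
  have hpow : ∀ k, Real.exp (-(j * ε k)) = g k ^ j := fun k => by
    rw [hg, ← Real.exp_nat_mul]; congr 1; ring
  have hji : Integrable fun k => g k ^ j :=
    hεi.mono' (hεc.pow j).aestronglyMeasurable (.of_forall fun k => by
      rw [Real.norm_of_nonneg (pow_nonneg (hg0 k) _)]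
      exact pow_le_of_le_one (hg0 k) (hg1 k) (by omega))
  have hpos : Tendsto (fun L => ∫ k, max (g k - g (cellPt d L k)) 0) atTop (𝓝 0) := by
    have h := tendsto_integral_filter_of_dominated_convergence (μ := volume) (l := atTop)
      (F := fun L k => max (g k - g (cellPt d L k)) 0) (f := fun _ => 0) g ?_ ?_ hεi ?_
    · simpa using h
    · exact .of_forall fun L => ((hgm.sub (hgm.comp (measurable_cellPt L))).max
        measurable_const).aestronglyMeasurable
    · refine .of_forall fun L => .of_forall fun k => ?_
      rw [Real.norm_of_nonneg (le_max_right _ _)]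
      exact max_le (by linarith [hg0 (cellPt d L k)]) (hg0 k)
    · refine .of_forall fun k => ?_
      have h1 : Tendsto (fun L => g (cellPt d L k)) atTop (𝓝 (g k)) :=
        (hεc.tendsto k).comp (tendsto_cellPt k)
      simpa using ((tendsto_const_nhds (x := g k)).sub h1).max (tendsto_const_nhds (x := (0:ℝ)))
  have hbound : Tendsto (fun L : ℝ => j * ((L ^ d)⁻¹ * ∑' z, g (dualPt d L z) - (∫ k, g k) +
      2 * ∫ k, max (g k - g (cellPt d L k)) 0)) atTop (𝓝 0) := by
    have := ((hRiemann.sub_const (∫ k, g k)).add (hpos.const_mul 2)).const_mul (j : ℝ)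
    simpa using this
  simp_rw [latSum, hpow]
  rw [tendsto_iff_norm_sub_tendsto_zero]
  refine squeeze_zero' (.of_forall fun _ => norm_nonneg _) ?_ hbound
  filter_upwards [hsum, eventually_gt_atTop 0] with L hs hL
  have hsj : Summable fun z => g (dualPt d L z) ^ j := by
    simpa only [hpow] using summable_exp_mul hε hs hj
  obtain ⟨hi1, he1⟩ := integrable_cellPt hL hgm hg0 hs
  obtain ⟨hi2, he2⟩ := integrable_cellPt hL (hgm.pow_const j) (fun k => pow_nonneg (hg0 k) j) hsj
  rw [← he1, ← he2, ← integral_sub hi2 hji]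
  have habs : ∀ k, ‖g (cellPt d L k) ^ j - g k ^ j‖ ≤
      j * (g (cellPt d L k) - g k + 2 * max (g k - g (cellPt d L k)) 0) := by
    intro k
    refine (abs_pow_sub_pow_le _ _ j).trans ?_
    have h1 : max |g (cellPt d L k)| |g k| ≤ 1 := by
      rw [abs_of_nonneg (hg0 _), abs_of_nonneg (hg0 _)]
      exact max_le (hg1 _) (hg1 _)
    refine (mul_le_of_le_one_right (by positivity) (pow_le_one₀ (by positivity) h1)).trans ?_
    rw [mul_comm]
    refine mul_le_mul_of_nonneg_left ?_ (by positivity)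
    rcases le_total (g k - g (cellPt d L k)) 0 with h | h
    · rw [max_eq_right h, abs_of_nonneg] <;> linarith
    · rw [max_eq_left h, abs_of_nonpos] <;> linarith
  have hmax : Integrable fun k => max (g k - g (cellPt d L k)) 0 := (hεi.sub hi1).pos_part
  calc _ ≤ ∫ k, ‖g (cellPt d L k) ^ j - g k ^ j‖ := norm_integral_le_integral_norm _
    _ ≤ ∫ k, j * (g (cellPt d L k) - g k + 2 * max (g k - g (cellPt d L k)) 0) :=
      integral_mono (hi2.sub hji).norm (((hi1.sub hεi).add (hmax.const_mul 2)).const_mul _) habs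
    _ = _ := by
      have h1 : ∫ k, g (cellPt d L k) - g k = (∫ k, g (cellPt d L k)) - ∫ k, g k :=
        integral_sub hi1 hεi
      have h2 : ∫ k, (g (cellPt d L k) - g k + 2 * max (g k - g (cellPt d L k)) 0) =
          (∫ k, g (cellPt d L k) - g k) + ∫ k, 2 * max (g k - g (cellPt d L k)) 0 :=
        integral_add (hi1.sub hεi) (hmax.const_mul 2)
      rw [integral_const_mul, h2, h1, integral_const_mul]

end RiemannSums

section Assembly

open scoped NNReal

variable {d : ℕ} {f ε : Eu d → ℝ}

open scoped Classical in
lemma gibbsP_mono {α : ℕ → ℝ} {L : ℝ} {n : ℕ} {A B : Set (Equiv.Perm (Fin n))} (h : A ⊆ B) :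
    gibbsP d f α L n A ≤ gibbsP d f α L n B := by
  unfold gibbsP
  refine div_le_div_of_nonneg_right (Finset.sum_le_sum fun π _ => ?_)
    (Finset.sum_nonneg fun _ _ => ENNReal.toReal_nonneg)
  by_cases hA : π ∈ A
  · rw [if_pos hA, if_pos (h hA)]
  · rw [if_neg hA]; split_ifs <;> simp

lemma gibbsP_nonneg {α : ℕ → ℝ} {L : ℝ} {n : ℕ} (A : Set (Equiv.Perm (Fin n))) :
    0 ≤ gibbsP d f α L n A := by
  unfold gibbsP
  exact div_nonneg (Finset.sum_nonneg fun _ _ => by split_ifs <;> simp)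
    (Finset.sum_nonneg fun _ _ => ENNReal.toReal_nonneg)

/-- The cycle counts are independent Poisson variables, conditioned on the total length. -/
lemma gibbsP_eq_poisson {α : ℕ → ℝ} {L : ℝ} {n : ℕ} {w : ℕ → ℝ≥0}
    (hw : ∀ π : Equiv.Perm (Fin n), (gibbsW d f α L n π).toReal =
      ((cycleLens π).map fun j => (w j : ℝ)).prod) (S : Set (Fin n → ℕ)) :
    gibbsP d f α L n {π | counts π ∈ S} =
      (poissonPi (rate w n)).real {v | linStat (len n) v = n ∧ v ∈ S} /
        (poissonPi (rate w n)).real {v | linStat (len n) v = n} := by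
  classical
  have h1 := sum_perm_eq_poisson (n := n) w S
  have h2 := sum_perm_eq_poisson (n := n) w Set.univ
  simp only [Set.mem_univ, if_true, and_true] at h2
  have h3 : (n.factorial : ℝ) * Real.exp (∑ i, (rate w n i : ℝ)) ≠ 0 :=
    mul_ne_zero (by exact_mod_cast n.factorial_ne_zero) (Real.exp_pos _).ne'
  unfold gibbsP
  simp only [hw, Set.mem_ofPred_eq]
  refine (congrArg₂ (· / ·) (Eq.trans ?_ h1) h2).trans (mul_div_mul_left _ _ h3)
  congr!

lemma exp_neg_eps_zero (hf_norm : ∫ x, f x = 1)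
    (hFT : ∀ k : Eu d, 𝓕 (fun x => (f x : ℂ)) k = (Real.exp (-ε k) : ℂ)) :
    Real.exp (-ε 0) = 1 := by
  have h := hFT 0
  rw [Real.fourier_eq'] at h
  simp only [inner_zero_right, mul_zero, Complex.ofReal_zero, zero_mul, Complex.exp_zero,
    one_smul] at h
  have h2 : ∫ x, (f x : ℂ) = ((∫ x, f x : ℝ) : ℂ) := integral_ofReal
  rw [h2, hf_norm] at h
  exact_mod_cast h.symm

lemma one_le_latSum (hε : ∀ k, 0 ≤ ε k) (h0 : Real.exp (-ε 0) = 1) {L : ℝ}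
    (hsum : Summable fun z => Real.exp (-ε (dualPt d L z))) {j : ℕ} (hj : 1 ≤ j) :
    1 ≤ latSum ε L j := by
  have h := (summable_exp_mul hε hsum hj).le_tsum 0 fun _ _ => (Real.exp_pos _).le
  have h1 : dualPt d L 0 = 0 := by ext i; simp
  have h2 : ε 0 = 0 := by simpa using h0
  simpa [h1, h2, latSum] using h

lemma exp_neg_mul_log {γ : ℝ} {j : ℕ} (hj : 1 ≤ j) :
    Real.exp (-(γ * Real.log j)) = (j : ℝ) ^ (-γ) := by
  rw [Real.rpow_def_of_pos (by exact_mod_cast hj)]; congr 1; ring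

/-- The density of points in the cycles shorter than any fixed power of `N` is critical. -/
lemma tendsto_density {α : ℕ → ℝ} {γ ρ p C : ℝ}
    (hα : ∀ j : ℕ, 1 ≤ j → Real.exp (-α j) = (j : ℝ) ^ (-γ))
    (hγ : 0 ≤ γ) (hρ : 0 < ρ) (hp : 1 < p) (hC : 0 ≤ C) {Ls : ℕ → ℝ} {Ns : ℕ → ℕ}
    (hLs : Tendsto Ls atTop atTop) (hfix : ∀ m, (Ns m : ℝ) = ρ * Ls m ^ d)
    (hNs : Tendsto Ns atTop atTop)
    (hbound : ∀ᶠ m in atTop, ∀ j : ℕ, 1 ≤ j →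
      latSum ε (Ls m) j ≤ 1 + C * (j : ℝ) ^ (-p) * Ls m ^ d)
    (hlim : ∀ j : ℕ, 1 ≤ j → Tendsto (fun L : ℝ => (L ^ d)⁻¹ * latSum ε L j) atTop
      (𝓝 (∫ k, Real.exp (-(j * ε k))))) :
    Tendsto (fun m => (∑ j ∈ Finset.Icc 1 (Ns m), if (j : ℝ) < (Ns m : ℝ) ^ (1 / p) then
      Real.exp (-α j) * latSum ε (Ls m) j else 0) / Ns m) atTop (𝓝 (rhoC d ε α / ρ)) := by
  have hp0 : 0 < p := by linarith
  have hNr : Tendsto (fun m => (Ns m : ℝ)) atTop atTop := tendsto_natCast_atTop_atTop.comp hNs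
  set F : ℕ → ℕ → ℝ := fun m i => if i + 1 ≤ Ns m ∧ ((i + 1 : ℕ) : ℝ) < (Ns m : ℝ) ^ (1 / p) then
    Real.exp (-α (i + 1)) * latSum ε (Ls m) (i + 1) / Ns m else 0 with hF
  have hsumF : ∀ m, (∑ j ∈ Finset.Icc 1 (Ns m), if (j : ℝ) < (Ns m : ℝ) ^ (1 / p) then
      Real.exp (-α j) * latSum ε (Ls m) j else 0) / Ns m = ∑' i, F m i := by
    intro m
    rw [tsum_eq_sum (s := Finset.range (Ns m)) fun i hi => if_neg fun h => hi
      (Finset.mem_range.2 (by omega)), Finset.sum_div, Finset.range_eq_Ico,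
      ← Finset.Ico_succ_right_eq_Icc, Finset.sum_Ico_eq_sum_range]
    refine Finset.sum_congr (by simp) fun i hi => ?_
    have hi' : i + 1 ≤ Ns m := by simp at hi; omega
    rw [add_comm 1 i]
    simp only [hi', true_and]
    split_ifs <;> simp
  simp_rw [hsumF, rhoC, ← tsum_div_const]
  refine tendsto_tsum_of_dominated_convergence
    (bound := fun i => (1 + C / ρ) * ((i + 1 : ℕ) : ℝ) ^ (-p)) ?_ (fun i => ?_) ?_
  · exact ((summable_nat_add_iff 1).2 (Real.summable_nat_rpow.2 (by linarith))).mul_left _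
  · have h1 : ∀ᶠ m in atTop, Real.exp (-α (i + 1)) * ((Ls m ^ d)⁻¹ * latSum ε (Ls m) (i + 1)) / ρ =
        F m i := by
      have h2 : ∀ᶠ m in atTop, ((i + 1 : ℕ) : ℝ) < (Ns m : ℝ) ^ (1 / p) :=
        ((tendsto_rpow_atTop (by positivity)).comp hNr).eventually_gt_atTop _
      filter_upwards [h2, hNs.eventually_ge_atTop (i + 1), hLs.eventually_gt_atTop 0]
        with m h2 h3 h4
      rw [hF]
      simp only
      rw [if_pos ⟨h3, h2⟩, hfix]
      field_simp
    refine Tendsto.congr' h1 ?_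
    have h3 := (((hlim (i + 1) (by omega)).comp hLs).const_mul (Real.exp (-α (i + 1)))).div_const ρ
    push_cast at h3
    exact h3
  · filter_upwards [hbound, hLs.eventually_gt_atTop 0, hNs.eventually_gt_atTop 0] with m hb hL hN i
    have hN' : (0 : ℝ) < Ns m := by exact_mod_cast hN
    have hj0 : (0 : ℝ) < ((i + 1 : ℕ) : ℝ) := by positivity
    simp only [hF]
    split_ifs with h
    · have h1 : (Ns m : ℝ)⁻¹ ≤ ((i + 1 : ℕ) : ℝ) ^ (-p) := by
        rw [Real.rpow_neg hj0.le]
        refine inv_anti₀ (by positivity) ?_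
        calc ((i + 1 : ℕ) : ℝ) ^ p ≤ ((Ns m : ℝ) ^ (1 / p)) ^ p :=
              Real.rpow_le_rpow hj0.le h.2.le hp0.le
          _ = Ns m := by rw [← Real.rpow_mul hN'.le, one_div_mul_cancel hp0.ne', Real.rpow_one]
      have h2 : Real.exp (-α (i + 1)) ≤ 1 := by
        rw [hα (i + 1) (by omega)]
        exact Real.rpow_le_one_of_one_le_of_nonpos (by simp) (by linarith)
      have h3 := latSum_nonneg (ε := ε) (Ls m) (i + 1)
      have h5 : Ls m ^ d / Ns m = 1 / ρ := by rw [hfix]; field_simp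
      rw [Real.norm_of_nonneg (by positivity)]
      calc _ ≤ 1 * (1 + C * ((i + 1 : ℕ) : ℝ) ^ (-p) * Ls m ^ d) / Ns m := by
            gcongr
            exact hb (i + 1) (by omega)
        _ = (Ns m : ℝ)⁻¹ + C * ((i + 1 : ℕ) : ℝ) ^ (-p) * (Ls m ^ d / Ns m) := by
            field_simp
        _ ≤ ((i + 1 : ℕ) : ℝ) ^ (-p) + C * ((i + 1 : ℕ) : ℝ) ^ (-p) * (1 / ρ) := by
            rw [h5]
            gcongr
        _ = _ := by ring
    · simp; positivity

lemma rhoC_pos {α : ℕ → ℝ} {γ p C : ℝ}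
    (hα : ∀ j : ℕ, 1 ≤ j → Real.exp (-α j) = (j : ℝ) ^ (-γ)) (hγ : 0 ≤ γ) (hp : 1 < p)
    (hintegral : ∀ j : ℕ, 1 ≤ j → ∫ k, Real.exp (-(j * ε k)) ≤ C * (j : ℝ) ^ (-p))
    (hpos : 0 < ∫ k, Real.exp (-ε k)) : 0 < rhoC d ε α := by
  have h0 : ∀ j : ℕ, 0 ≤ Real.exp (-α (j + 1)) * ∫ k, Real.exp (-(((j : ℝ) + 1) * ε k)) := fun j =>
    mul_nonneg (Real.exp_pos _).le (integral_nonneg fun _ => (Real.exp_pos _).le)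
  have hs : Summable fun j : ℕ =>
      Real.exp (-α (j + 1)) * ∫ k, Real.exp (-(((j : ℝ) + 1) * ε k)) := by
    refine .of_nonneg_of_le h0 (fun j => ?_)
      (((summable_nat_add_iff 1).2 (Real.summable_nat_rpow.2 (by linarith : -p < -1))).mul_left C)
    have h1 := hintegral (j + 1) (by omega)
    have h2 : Real.exp (-α (j + 1)) ≤ 1 := by
      rw [hα (j + 1) (by omega)]
      exact Real.rpow_le_one_of_one_le_of_nonpos (by simp) (by linarith)
    push_cast at h1 ⊢
    exact (mul_le_of_le_one_left (integral_nonneg fun _ => (Real.exp_pos _).le) h2).trans h1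
  refine hs.tsum_pos h0 0 ?_
  exact mul_pos (Real.exp_pos _) (by simpa using hpos)

end Assembly

/-- Theorem 2.2 (b): with cycle weights `α_j = γ log j`, `γ > 0`, and
`ρ > ρ_c` (so `ν = 1 - ρ_c/ρ > 0`), there is a single giant cycle containing almost all
points in infinite cycles: in the thermodynamic limit with fixed density `ρ = N/|Λ|`,
`ℓ⁽¹⁾/(νN)` converges in distribution (equivalently, in probability) to the constant 1. -/
theorem statement3
    (d : ℕ) (hd : 1 ≤ d) (f ε : Eu d → ℝ) (α : ℕ → ℝ)
    -- assumptions on the jump function `f = e^{-ξ}`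
    (hf_cont : Continuous f) (hf_nonneg : ∀ x, 0 ≤ f x)
    (hf_norm : ∫ x : Eu d, f x = 1)
    -- the Fourier transform of `e^{-ξ}` is the positive function `e^{-ε}`
    (hFT : ∀ k : Eu d, 𝓕 (fun x => (f x : ℂ)) k = (Real.exp (-ε k) : ℂ))
    -- assumptions on the dispersion relation `ε`
    (hε_nonneg : ∀ k, 0 ≤ ε k)
    (hε_uc : UniformContinuous fun k => Real.exp (-ε k))
    (hε_low : ∃ a > (0:ℝ), ∃ η : ℝ, 0 < η ∧ η < d ∧
      ∀ k : Eu d, ‖k‖ ≤ 1 → a * ‖k‖ ^ η ≤ ε k)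
    (hε_pos : ∀ δ : ℝ, 0 < δ → ∃ c > (0:ℝ), ∀ k : Eu d, δ ≤ ‖k‖ → c ≤ ε k)
    -- the periodization `e^{-ξ_Λ}` is continuous for all large `L`
    (hper_cont : ∃ L₀ : ℝ, ∀ L ≥ L₀, Continuous (fper d f L))
    -- convergence of the Riemann sums `|Λ|⁻¹ ∑_{k∈Λ*} e^{-ε(k)} → ∫ e^{-ε(k)} dk`
    (hRiemann : Tendsto
      (fun L : ℝ => (L ^ d)⁻¹ * ∑' z : Fin d → ℤ, Real.exp (-ε (dualPt d L z)))
      atTop (𝓝 (∫ k : Eu d, Real.exp (-ε k))))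
    -- logarithmically divergent cycle weights
    (γ : ℝ) (hγ : 0 < γ) (hα : ∀ j : ℕ, 1 ≤ j → α j = γ * Real.log j)
    -- supercritical density: `ρ > ρ_c`, so that `ν = 1 - ρ_c/ρ > 0`
    (ρ : ℝ) (hρ : 0 < ρ) (hcrit : rhoC d ε α < ρ)
    -- thermodynamic limit at fixed density `ρ`
    (Ls : ℕ → ℝ) (Ns : ℕ → ℕ)
    (hLs : Tendsto Ls atTop atTop)
    (hfix : ∀ m, (Ns m : ℝ) = ρ * Ls m ^ d) :
    ∀ e : ℝ, 0 < e →
      Tendsto (fun m => gibbsP d f α (Ls m) (Ns m)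
          {π | e < |(ellD π 0 : ℝ) / ((1 - rhoC d ε α / ρ) * Ns m) - 1|})
        atTop (𝓝 0) := by
  classical
  intro e he
  have hf_int := integrable_of_integral_eq_one hf_norm
  have hεc := hε_uc.continuous
  have hεi := integrable_exp_neg_of_fourier hf_cont hf_int hFT hε_nonneg hεc
  have h0 := exp_neg_eps_zero hf_norm hFT
  have hI : 0 < ∫ k : Eu d, Real.exp (-ε k) := by
    refine (integral_pos_iff_support_of_nonneg (fun _ => (Real.exp_pos _).le) hεi).2 ?_
    have : Function.support (fun k : Eu d => Real.exp (-ε k)) = Set.univ :=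
      Set.eq_univ_of_forall fun k => (Real.exp_pos _).ne'
    rw [this]
    exact (Measure.measure_univ_pos).2 (NeZero.ne _)
  have hsum : ∀ᶠ L in atTop, Summable fun z => Real.exp (-ε (dualPt d L z)) := by
    filter_upwards [hRiemann.eventually (lt_mem_nhds hI)] with L hL
    by_contra h
    rw [tsum_eq_zero_of_not_summable h, mul_zero] at hL
    exact lt_irrefl _ hL
  have hα' : ∀ j : ℕ, 1 ≤ j → Real.exp (-α j) = (j : ℝ) ^ (-γ) := fun j hj => by
    rw [hα j hj, exp_neg_mul_log hj]
  obtain ⟨p, hp, C, hC, hbound⟩ := exists_latSum_le hd hε_nonneg hε_low hε_pos hRiemann hsum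
  have hlim := fun (j : ℕ) (hj : 1 ≤ j) => tendsto_latSum hε_nonneg hεc hεi hRiemann hsum hj
  have hintegral : ∀ j : ℕ, 1 ≤ j → ∫ k : Eu d, Real.exp (-(j * ε k)) ≤ C * (j : ℝ) ^ (-p) := by
    intro j hj
    have h1 : Tendsto (fun L : ℝ => (L ^ d)⁻¹ + C * (j : ℝ) ^ (-p)) atTop
        (𝓝 (0 + C * (j : ℝ) ^ (-p))) :=
      (tendsto_inv_atTop_zero.comp (tendsto_pow_atTop (by omega))).add_const _
    rw [zero_add] at h1
    refine le_of_tendsto_of_tendsto (hlim j hj) h1 ?_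
    filter_upwards [hbound, eventually_gt_atTop 0] with L hL hL0
    calc (L ^ d)⁻¹ * latSum ε L j ≤ (L ^ d)⁻¹ * (1 + C * (j : ℝ) ^ (-p) * L ^ d) := by
          gcongr
          exact hL j hj
      _ = _ := by field_simp
  have hσ0 : 0 < rhoC d ε α / ρ := div_pos (rhoC_pos hα' hγ.le hp hintegral hI) hρ
  have hσ1 : rhoC d ε α / ρ < 1 := (div_lt_one hρ).2 hcrit
  have hNs : Tendsto Ns atTop atTop := by
    refine tendsto_natCast_atTop_iff (R := ℝ).1 ?_
    simp_rw [hfix]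
    exact ((tendsto_pow_atTop (by omega)).comp hLs).const_mul_atTop hρ
  have hdens := tendsto_density hα' hγ.le hρ hp hC hLs hfix hNs (hLs.eventually hbound) hlim
  set σ := rhoC d ε α / ρ with hσ
  have hw0 : ∀ m j, 0 ≤ Real.exp (-α j) * latSum ε (Ls m) j := fun m j =>
    mul_nonneg (Real.exp_pos _).le (latSum_nonneg _ _)
  set w : ℕ → ℕ → NNReal := fun m j => (Real.exp (-α j) * latSum ε (Ls m) j).toNNReal with hwdef
  have hw : ∀ m j, (w m j : ℝ) = Real.exp (-α j) * latSum ε (Ls m) j := fun m j =>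
    Real.coe_toNNReal _ (hw0 m j)
  set e' := min (σ / 2) (min ((1 - σ) / 2) (e * (1 - σ) / 2)) with he'
  have he0 : 0 < e' := by
    have : 0 < 1 - σ := by linarith
    positivity
  have he1 : e' ≤ σ / 2 := min_le_left _ _
  have he2 : e' ≤ (1 - σ) / 2 := (min_le_right _ _).trans (min_le_left _ _)
  have he3 : e' ≤ e * (1 - σ) / 2 := (min_le_right _ _).trans (min_le_right _ _)
  have hjump := tendsto_one_big_jump γ p (1 + C / ρ) σ e' hγ hp (by positivity) he0
    (by linarith) (by linarith) Ns hNs w ?_ ?_ (by simpa only [hw] using hdens)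
  · obtain ⟨L₀, hL₀⟩ := hper_cont
    refine squeeze_zero' (.of_forall fun m => gibbsP_nonneg _) ?_ hjump
    filter_upwards [hLs.eventually hsum, hLs.eventually_gt_atTop 0, hLs.eventually_ge_atTop L₀,
      hNs.eventually_gt_atTop 0] with m hm hL hLL hN
    have hN' : (0 : ℝ) < Ns m := by exact_mod_cast hN
    refine le_of_le_of_eq (gibbsP_mono fun π hπ => ?_) (gibbsP_eq_poisson (w := w m) (fun π => ?_)
      {v | ¬ ((∃ i, v i ≠ 0 ∧ (1 - σ - 2 * e') * Ns m ≤ len (Ns m) i) ∧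
        ∀ i, v i ≠ 0 → (len (Ns m) i : ℝ) ≤ (1 - σ + e') * Ns m)})
    · intro h
      obtain ⟨hl, hu⟩ := ellD_bounds hN h
      refine not_le.2 (Set.mem_ofPred_eq ▸ hπ : e < _) ?_
      have hν : 0 < (1 - σ) * Ns m := mul_pos (by linarith) hN'
      rw [div_sub_one hν.ne', abs_div, abs_of_pos hν, div_le_iff₀ hν, abs_le]
      constructor <;> nlinarith
    · rw [toReal_gibbsW α hf_cont hf_nonneg hf_int hFT hε_nonneg hL (hL₀ _ hLL) hm]
      simp only [hw, latSum]
  · filter_upwards [hLs.eventually hsum] with m hm j hj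
    rw [hw, ← hα' j hj]
    exact le_mul_of_one_le_right (Real.exp_pos _).le (one_le_latSum hε_nonneg h0 hm hj)
  · filter_upwards [hLs.eventually hbound, hLs.eventually_gt_atTop 0, hNs.eventually_gt_atTop 0]
      with m hb hL hN j hj
    have hN' : (1 : ℝ) ≤ Ns m := by exact_mod_cast hN
    have hp0 : 0 < p := by linarith
    have hj1 : (1 : ℝ) ≤ j := (Real.one_le_rpow hN' (by positivity)).trans hj
    have hjn : 1 ≤ j := by exact_mod_cast hj1
    have h1 : (j : ℝ) ^ (-p) ≤ (Ns m : ℝ)⁻¹ := by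
      rw [Real.rpow_neg (by linarith)]
      refine inv_anti₀ (by linarith) ?_
      calc (Ns m : ℝ) = ((Ns m : ℝ) ^ (1 / p)) ^ p := by
            rw [← Real.rpow_mul (by linarith), one_div_mul_cancel hp0.ne', Real.rpow_one]
        _ ≤ (j : ℝ) ^ p := Real.rpow_le_rpow (by positivity) hj hp0.le
    have h2 : latSum ε (Ls m) j ≤ 1 + C / ρ :=
      calc _ ≤ 1 + C * (j : ℝ) ^ (-p) * Ls m ^ d := hb j hjn
        _ ≤ 1 + C * (Ns m : ℝ)⁻¹ * Ls m ^ d := by gcongr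
        _ = 1 + C / ρ := by rw [hfix]; field_simp
    rw [hw, hα' j hjn, mul_comm]
    exact mul_le_mul_of_nonneg_right h2 (by positivity)
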